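/- Let d ≢ 1 (mod 4). There exist constants C, c > 0 such that for every 0 < r < 1/4, every integer N, every even integer M with M ≥ C·N^{1 + 1/(2d)}·r^{-1}, and every finite sequence P_N = {p_n}_{n=1}^N in 𝕋^d, ((card J_M)^{-d} Σ_{k=1,2} Σ_{j∈J_M^d} |D((j₁/M,...,j_d/M) + B_{kr}, P_N)|²)^{1/2} ≥ c·r^{d/2}·N^{1/2 - 1/(2d)}, where D(x + B_s, P_N) = Σ_n χ_{x+B_s}(p_n) - N|B_s|. -/

import Mathlib

open MeasureTheory

/-- The additive character `t ↦ exp (2πit)` of `ℝ`, as a complex number. -/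
noncomputable def torusChar (t : ℝ) : ℂ := Complex.exp ((2 * Real.pi * t : ℝ) * Complex.I)

theorem torusChar_add (s t : ℝ) : torusChar (s + t) = torusChar s * torusChar t := by
  rw [torusChar, torusChar, torusChar, ← Complex.exp_add]
  congr 1
  push_cast
  ring

theorem norm_torusChar (t : ℝ) : ‖torusChar t‖ = 1 :=
  Complex.norm_exp_ofReal_mul_I _

theorem torusChar_zero : torusChar 0 = 1 := by simp [torusChar]

theorem torusChar_neg (t : ℝ) : torusChar (-t) = (starRingEnd ℂ) (torusChar t) := by
  rw [torusChar, torusChar, ← Complex.exp_conj, map_mul, Complex.conj_ofReal, Complex.conj_I]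
  congr 1
  push_cast
  ring

theorem torusChar_sub (s t : ℝ) :
    torusChar (s - t) = torusChar s * (starRingEnd ℂ) (torusChar t) := by
  rw [sub_eq_add_neg, torusChar_add, torusChar_neg]

theorem torusChar_int (n : ℤ) : torusChar n = 1 := by
  rw [torusChar, Complex.exp_eq_one_iff]
  exact ⟨n, by push_cast; ring⟩

theorem torusChar_eq_one_iff (t : ℝ) : torusChar t = 1 ↔ ∃ n : ℤ, t = n := by
  refine ⟨fun h => ?_, ?_⟩
  · rw [torusChar, Complex.exp_eq_one_iff] at h
    obtain ⟨n, hn⟩ := h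
    refine ⟨n, ?_⟩
    have h2 : ((2 * Real.pi : ℝ) : ℂ) * Complex.I ≠ 0 := by
      simp [Real.pi_ne_zero]
    have : ((t : ℝ) : ℂ) = ((n : ℝ) : ℂ) := by
      apply mul_right_cancel₀ h2
      push_cast at hn ⊢
      linear_combination hn
    exact_mod_cast this
  · rintro ⟨n, rfl⟩
    exact torusChar_int n

theorem torusChar_nat_mul (n : ℕ) (t : ℝ) : torusChar (n * t) = torusChar t ^ n := by
  induction n with
  | zero => simp [torusChar_zero]
  | succ n ih => rw [pow_succ, ← ih, ← torusChar_add]; congr 1; push_cast; ring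

theorem torusChar_sum {ι : Type*} (s : Finset ι) (f : ι → ℝ) :
    torusChar (∑ i ∈ s, f i) = ∏ i ∈ s, torusChar (f i) := by
  classical
  induction s using Finset.induction_on with
  | empty => simp [torusChar_zero]
  | insert a s ha ih => rw [Finset.sum_insert ha, Finset.prod_insert ha, torusChar_add, ih]

theorem continuous_torusChar : Continuous torusChar := by
  unfold torusChar
  fun_prop

/-- The exponential sum of the points `p` at the frequency `m`. -/
noncomputable def expSum {d N : ℕ} (p : Fin N → Fin d → ℝ) (m : Fin d → ℤ) : ℂ :=
  ∑ n, torusChar (∑ i, (m i : ℝ) * p n i)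

theorem norm_expSum_le {d N : ℕ} (p : Fin N → Fin d → ℝ) (m : Fin d → ℤ) :
    ‖expSum p m‖ ≤ N := by
  refine (norm_sum_le _ _).trans ?_
  simp [norm_torusChar]

theorem sum_sq_norm_expSum_sub {d N : ℕ} (p : Fin N → Fin d → ℝ) (Q : Finset (Fin d → ℤ)) :
    ∑ k' ∈ Q, ∑ k ∈ Q, ‖expSum p (k - k')‖ ^ 2 =
      ∑ n, ∑ n', ‖∑ k ∈ Q, torusChar (∑ i, (k i : ℝ) * (p n i - p n' i))‖ ^ 2 := by
  have key : ∀ (k k' : Fin d → ℤ) (n n' : Fin N),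
      torusChar (∑ i, ((k - k') i : ℝ) * p n i) *
        (starRingEnd ℂ) (torusChar (∑ i, ((k - k') i : ℝ) * p n' i)) =
      torusChar (∑ i, (k i : ℝ) * (p n i - p n' i)) *
        (starRingEnd ℂ) (torusChar (∑ i, (k' i : ℝ) * (p n i - p n' i))) := by
    intro k k' n n'
    rw [← torusChar_sub, ← torusChar_sub, ← Finset.sum_sub_distrib, ← Finset.sum_sub_distrib]
    congr 1
    refine Finset.sum_congr rfl fun i _ => ?_
    simp only [Pi.sub_apply, Int.cast_sub]
    ring
  have : ∑ k' ∈ Q, ∑ k ∈ Q, ((‖expSum p (k - k')‖ ^ 2 : ℝ) : ℂ) =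
      ∑ n, ∑ n', ((‖∑ k ∈ Q, torusChar (∑ i, (k i : ℝ) * (p n i - p n' i))‖ ^ 2 : ℝ) : ℂ) := by
    simp only [Complex.ofReal_pow, ← Complex.mul_conj', expSum, map_sum, Finset.sum_mul_sum, key]
    calc _ = ∑ k' ∈ Q, ∑ n, ∑ n', ∑ k ∈ Q, _ := by
          refine Finset.sum_congr rfl fun k' _ => ?_
          rw [Finset.sum_comm]
          exact Finset.sum_congr rfl fun n _ => Finset.sum_comm
      _ = _ := by
          rw [Finset.sum_comm]
          refine Finset.sum_congr rfl fun n _ => ?_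
          rw [Finset.sum_comm]
          exact Finset.sum_congr rfl fun n _ => Finset.sum_comm
  exact_mod_cast this

/-- Cassels–Montgomery lower bound for exponential sums over a translate of `Q`. -/
theorem exists_card_mul_le_sum_sq_norm_expSum {d N : ℕ} (p : Fin N → Fin d → ℝ)
    (Q : Finset (Fin d → ℤ)) (hQ : Q.Nonempty) :
    ∃ k' ∈ Q, (N : ℝ) * Q.card ≤ ∑ k ∈ Q, ‖expSum p (k - k')‖ ^ 2 := by
  apply Finset.exists_le_of_sum_le hQ
  rw [sum_sq_norm_expSum_sub, Finset.sum_const, nsmul_eq_mul]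
  calc (Q.card : ℝ) * (N * Q.card) = ∑ _n : Fin N, (Q.card : ℝ) ^ 2 := by
        rw [Finset.sum_const, Finset.card_univ, Fintype.card_fin, nsmul_eq_mul]; ring
    _ ≤ _ := by
        refine Finset.sum_le_sum fun n _ => ?_
        refine le_trans (le_of_eq ?_) (Finset.single_le_sum
          (f := fun n' => ‖∑ k ∈ Q, torusChar (∑ i, (k i : ℝ) * (p n i - p n' i))‖ ^ 2)
          (fun _ _ => by positivity) (Finset.mem_univ n))
        simp [torusChar_zero]

theorem sum_Ico_torusChar_eq_zero (M : ℕ) (a b : ℤ) (hb : ¬ (M : ℤ) ∣ b) :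
    ∑ j ∈ Finset.Ico a (a + M), torusChar (b * (j / M)) = 0 := by
  rcases Nat.eq_zero_or_pos M with rfl | hM
  · simp
  have hM' : (M : ℝ) ≠ 0 := by positivity
  have h1 : torusChar (b / M) ≠ 1 := by
    rw [Ne, torusChar_eq_one_iff]
    rintro ⟨n, hn⟩
    rw [div_eq_iff hM'] at hn
    exact hb ⟨n, by rw [mul_comm]; exact_mod_cast hn⟩
  have hshift : ∀ x : ℤ, ∑ j ∈ Finset.Ico x (x + M), torusChar (b * (j / M)) =
      ∑ t ∈ Finset.range M, torusChar (b / M) ^ t * torusChar (b * (x / M)) := by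
    intro x
    refine (Finset.sum_nbij' (fun t : ℕ => x + (t : ℤ)) (fun j => (j - x).toNat) ?_ ?_ ?_ ?_ ?_).symm
    · intro t ht; simp at ht ⊢; omega
    · intro t ht; simp at ht ⊢; omega
    · intro t ht; simp
    · intro t ht; simp at ht ⊢; omega
    · intro t ht
      rw [← torusChar_nat_mul, ← torusChar_add]
      congr 1
      push_cast
      ring
  rw [hshift, ← Finset.sum_mul]
  have hgeom := mul_neg_geom_sum (torusChar (b / M)) M
  have hM1 : torusChar (b / M) ^ M = 1 := by
    rw [← torusChar_nat_mul, mul_div_cancel₀ _ hM', torusChar_int]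
  rw [hM1, sub_self] at hgeom
  rcases mul_eq_zero.1 hgeom with h | h
  · exact absurd (sub_eq_zero.1 h).symm h1
  · rw [h, zero_mul]

/-- Orthogonality of characters on the grid. -/
theorem sum_grid_torusChar_eq_zero {d : ℕ} (M : ℕ) (a : ℤ) (m : Fin d → ℤ)
    (hm : ∃ i, ¬ (M : ℤ) ∣ m i) :
    ∑ j ∈ Fintype.piFinset fun _ : Fin d => Finset.Ico a (a + M),
      torusChar (∑ i, (m i : ℝ) * ((j i : ℝ) / M)) = 0 := by
  obtain ⟨i, hi⟩ := hm
  simp only [torusChar_sum]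
  rw [← Finset.prod_univ_sum (fun _ : Fin d => Finset.Ico a (a + M))
    (fun i j => torusChar ((m i : ℝ) * ((j : ℝ) / M)))]
  exact Finset.prod_eq_zero (Finset.mem_univ i) (sum_Ico_torusChar_eq_zero M a (m i) hi)

/-- Bessel's inequality for orthogonal unimodular functions on a finite set. -/
theorem sum_sq_norm_sum_mul_conj_le {ι κ : Type*} (J : Finset ι) (T : Finset κ)
    (f : ι → ℂ) (χ : κ → ι → ℂ) (hχ : ∀ m j, ‖χ m j‖ = 1)
    (horth : ∀ m ∈ T, ∀ m' ∈ T, m ≠ m' → ∑ j ∈ J, χ m j * (starRingEnd ℂ) (χ m' j) = 0) :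
    ∑ m ∈ T, ‖∑ j ∈ J, f j * (starRingEnd ℂ) (χ m j)‖ ^ 2 ≤ J.card * ∑ j ∈ J, ‖f j‖ ^ 2 := by
  classical
  rcases J.eq_empty_or_nonempty with rfl | hJ
  · simp
  have hc : (0 : ℝ) < J.card := by exact_mod_cast hJ.card_pos
  let v : T → EuclideanSpace ℂ J :=
    fun m => WithLp.toLp 2 fun j => ((Real.sqrt J.card)⁻¹ : ℂ) * χ m j
  have hsq : ((Real.sqrt J.card : ℂ)⁻¹) * (Real.sqrt J.card : ℂ)⁻¹ = ((J.card : ℝ) : ℂ)⁻¹ := by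
    rw [← mul_inv, ← Complex.ofReal_mul, Real.mul_self_sqrt hc.le]
  have hcc : ((J.card : ℝ) : ℂ) ≠ 0 := by exact_mod_cast hc.ne'
  have hin : ∀ m m' : T, inner ℂ (v m) (v m') =
      ((J.card : ℝ) : ℂ)⁻¹ * ∑ j ∈ J, χ m' j * (starRingEnd ℂ) (χ m j) := by
    intro m m'
    rw [PiLp.inner_apply, ← Finset.sum_coe_sort J, Finset.mul_sum]
    refine Finset.sum_congr rfl fun j _ => ?_
    simp only [v, RCLike.inner_apply, map_mul, map_inv₀, Complex.conj_ofReal, ← hsq]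
    ring
  have hv : Orthonormal ℂ v := by
    rw [orthonormal_iff_ite]
    intro m m'
    rw [hin]
    split_ifs with h
    · subst h
      simp only [Complex.mul_conj', hχ]
      simpa using inv_mul_cancel₀ hcc
    · rw [horth m' m'.2 m m.2 (fun h' => h (Subtype.ext h'.symm)), mul_zero]
  let F : EuclideanSpace ℂ J := WithLp.toLp 2 fun j => f j
  have hB := hv.sum_inner_products_le F (s := Finset.univ)
  have hF : ‖F‖ ^ 2 = ∑ j ∈ J, ‖f j‖ ^ 2 := by
    rw [EuclideanSpace.norm_sq_eq, ← Finset.sum_coe_sort J]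
  have hvF : ∀ m : T, ‖inner ℂ (v m) F‖ ^ 2 =
      (J.card : ℝ)⁻¹ * ‖∑ j ∈ J, f j * (starRingEnd ℂ) (χ m j)‖ ^ 2 := by
    intro m
    have : inner ℂ (v m) F =
        (Real.sqrt J.card : ℂ)⁻¹ * ∑ j ∈ J, f j * (starRingEnd ℂ) (χ m j) := by
      rw [PiLp.inner_apply, ← Finset.sum_coe_sort J, Finset.mul_sum]
      refine Finset.sum_congr rfl fun j _ => ?_
      simp only [v, F, RCLike.inner_apply, map_mul, map_inv₀, Complex.conj_ofReal]
      ring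
    rw [this, norm_mul, mul_pow, norm_inv, Complex.norm_real, inv_pow, Real.norm_eq_abs, sq_abs,
      Real.sq_sqrt hc.le]
  rw [hF] at hB
  simp only [hvF] at hB
  rw [← Finset.mul_sum, Finset.sum_coe_sort T
    (fun m => ‖∑ j ∈ J, f j * (starRingEnd ℂ) (χ m j)‖ ^ 2)] at hB
  rwa [inv_mul_le_iff₀ hc] at hB

/-- One-dimensional Watson lemma on the unit interval. -/
theorem norm_integral_rpow_mul_exp_sub_le {ν : ℝ} (hν : 0 < ν) (φ : ℝ → ℂ) (a : ℂ) (B : ℝ)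
    (hφ : ContinuousOn φ (Set.Icc 0 1)) (hB : ∀ y ∈ Set.Icc (0 : ℝ) 1, ‖φ y - a‖ ≤ B * y)
    {ρ : ℝ} (hρ : 0 < ρ) :
    ‖(∫ y in (0 : ℝ)..1, φ y * ((y ^ ν * Real.exp (-(ρ * y)) : ℝ) : ℂ)) -
        a * (((1 / ρ) ^ (ν + 1) * Real.Gamma (ν + 1) : ℝ) : ℂ)‖ ≤
      (B + ‖a‖) * ((1 / ρ) ^ (ν + 2) * Real.Gamma (ν + 2)) := by
  have hB0 : 0 ≤ B := by
    have := (norm_nonneg _).trans (hB 1 (by simp))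
    simpa using this
  have hint : ∀ s : ℝ, 0 < s →
      ∫ y in Set.Ioi (0 : ℝ), y ^ s * Real.exp (-(ρ * y)) =
        (1 / ρ) ^ (s + 1) * Real.Gamma (s + 1) := by
    intro s hs
    have := Real.integral_rpow_mul_exp_neg_mul_Ioi (a := s + 1) (r := ρ) (by linarith) hρ
    simpa using this
  have hintg : ∀ s : ℝ, 0 < s →
      IntegrableOn (fun y : ℝ => y ^ s * Real.exp (-(ρ * y))) (Set.Ioi 0) := by
    intro s hs
    have := integrableOn_rpow_mul_exp_neg_mul_rpow (s := s) (p := 1) (by linarith) one_pos hρ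
    simpa using this
  have h1 : (∫ y in (0 : ℝ)..1, φ y * ((y ^ ν * Real.exp (-(ρ * y)) : ℝ) : ℂ)) =
      ∫ y in Set.Ioi (0 : ℝ), (Set.Ioc (0 : ℝ) 1).indicator
        (fun y => φ y * ((y ^ ν * Real.exp (-(ρ * y)) : ℝ) : ℂ)) y := by
    rw [intervalIntegral.integral_of_le zero_le_one, setIntegral_indicator measurableSet_Ioc,
      Set.inter_eq_self_of_subset_right Set.Ioc_subset_Ioi_self]
  have h2 : a * (((1 / ρ) ^ (ν + 1) * Real.Gamma (ν + 1) : ℝ) : ℂ) =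
      ∫ y in Set.Ioi (0 : ℝ), a * ((y ^ ν * Real.exp (-(ρ * y)) : ℝ) : ℂ) := by
    rw [integral_const_mul, integral_complex_ofReal, hint ν hν]
  have hi1 : IntegrableOn (fun y => φ y * ((y ^ ν * Real.exp (-(ρ * y)) : ℝ) : ℂ))
      (Set.Ioc (0 : ℝ) 1) := by
    refine (ContinuousOn.integrableOn_Icc ?_).mono_set Set.Ioc_subset_Icc_self
    refine hφ.mul (Complex.continuous_ofReal.comp_continuousOn ?_)
    exact ((Real.continuous_rpow_const hν.le).mul (by fun_prop)).continuousOn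
  rw [h1, h2, ← integral_sub, ← show ν + 1 + 1 = ν + 2 by ring, ← hint (ν + 1) (by linarith),
    ← integral_const_mul]
  · refine norm_integral_le_of_norm_le ((hintg (ν + 1) (by linarith)).const_mul _) ?_
    refine (ae_restrict_iff' measurableSet_Ioi).2 (Filter.Eventually.of_forall fun y hy => ?_)
    have hy : 0 < y := hy
    have hw : 0 ≤ y ^ ν * Real.exp (-(ρ * y)) := by positivity
    rw [Real.rpow_add_one hy.ne']
    by_cases hy1 : y ∈ Set.Ioc (0 : ℝ) 1
    · rw [Set.indicator_of_mem hy1, ← sub_mul, norm_mul, Complex.norm_real, Real.norm_of_nonneg hw]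
      have := hB y ⟨hy1.1.le, hy1.2⟩
      have h3 : ‖φ y - a‖ ≤ (B + ‖a‖) * y := by nlinarith [norm_nonneg a]
      calc _ ≤ (B + ‖a‖) * y * (y ^ ν * Real.exp (-(ρ * y))) :=
            mul_le_mul_of_nonneg_right h3 hw
        _ = _ := by ring
    · rw [Set.indicator_of_notMem hy1, zero_sub, norm_neg, norm_mul, Complex.norm_real,
        Real.norm_of_nonneg hw]
      have h1y : 1 ≤ y := by
        by_contra h
        exact hy1 ⟨hy, by linarith⟩
      have h3 : ‖a‖ ≤ (B + ‖a‖) * y := by nlinarith [norm_nonneg a]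
      calc _ ≤ (B + ‖a‖) * y * (y ^ ν * Real.exp (-(ρ * y))) :=
            mul_le_mul_of_nonneg_right h3 hw
        _ = _ := by ring
  · rw [integrable_indicator_iff measurableSet_Ioc]
    exact hi1.mono_measure Measure.restrict_le_self
  · exact ((hintg ν hν).ofReal).const_mul a

theorem exists_norm_two_add_mul_cpow_sub_le (ν : ℝ) (w : ℂ) (hw : w.re = 0) :
    ∃ B : ℝ, ∀ y ∈ Set.Icc (0 : ℝ) 1,
      ‖(2 + y * w) ^ (ν : ℂ) - (((2 : ℝ) ^ ν : ℝ) : ℂ)‖ ≤ B * y := by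
  have hslit : ∀ y : ℝ, (2 + y * w : ℂ) ∈ Complex.slitPlane := by
    intro y
    left
    simp [hw]
  have hderiv : ∀ y : ℝ, HasDerivAt (fun y : ℝ => (2 + y * w : ℂ) ^ (ν : ℂ))
      ((ν : ℂ) * (2 + y * w) ^ ((ν : ℂ) - 1) * w) y := by
    intro y
    have h1 : HasDerivAt (fun z : ℂ => 2 + z * w) w (y : ℂ) := by
      simpa using ((hasDerivAt_id (y : ℂ)).mul_const w).const_add 2
    exact (h1.cpow_const (hslit y)).comp_ofReal
  have hcont : Continuous fun y : ℝ => (ν : ℂ) * (2 + y * w) ^ ((ν : ℂ) - 1) * w := by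
    refine (continuous_const.mul ?_).mul continuous_const
    exact Continuous.cpow (by fun_prop) continuous_const hslit
  obtain ⟨B, hB⟩ := isCompact_Icc.exists_bound_of_continuousOn (s := Set.Icc (0 : ℝ) 1)
    hcont.continuousOn
  refine ⟨B, fun y hy => ?_⟩
  have := norm_image_sub_le_of_norm_deriv_le_segment' (a := (0 : ℝ)) (b := 1)
    (fun x _ => (hderiv x).hasDerivWithinAt) (fun x hx => hB x ⟨hx.1, hx.2.le⟩) y hy
  rw [Complex.ofReal_cpow zero_le_two]
  simpa using this

theorem ofReal_mul_cpow_ofReal {ν y : ℝ} (hν : 0 < ν) (hy : 0 ≤ y) (z : ℂ) (hz : z ≠ 0) :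
    ((y : ℂ) * z) ^ (ν : ℂ) = ((y ^ ν : ℝ) : ℂ) * z ^ (ν : ℂ) := by
  rcases hy.eq_or_lt with rfl | hy
  · simp [hν.ne', Real.zero_rpow hν.ne']
  · have hy' : (y : ℂ) ≠ 0 := by exact_mod_cast hy.ne'
    rw [Complex.ofReal_cpow hy.le, Complex.cpow_def_of_ne_zero (mul_ne_zero hy' hz),
      Complex.cpow_def_of_ne_zero hy', Complex.cpow_def_of_ne_zero hz, ← Complex.exp_add,
      Complex.log_ofReal_mul hy hz, Complex.ofReal_log hy.le, add_mul]

/-- The Fourier transform of `(1 - t²)^ν` on `[-1, 1]`. -/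
noncomputable def poissonIntegral (ν ρ : ℝ) : ℂ :=
  ∫ t in (-1 : ℝ)..1, (((1 - t ^ 2) ^ ν : ℝ) : ℂ) * Complex.exp (((ρ * t : ℝ) : ℂ) * Complex.I)

open Complex in
theorem poissonIntegral_eq_contour {ν : ℝ} (hν : 0 < ν) (ρ : ℝ) :
    poissonIntegral ν ρ =
      I * I ^ (ν : ℂ) * exp (-((ρ : ℂ) * I)) *
          (∫ y in (0 : ℝ)..1, (2 + y * -I) ^ (ν : ℂ) * ((y ^ ν * Real.exp (-(ρ * y)) : ℝ) : ℂ)) +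
        (-I) * (-I) ^ (ν : ℂ) * exp ((ρ : ℂ) * I) *
          (∫ y in (0 : ℝ)..1, (2 + y * I) ^ (ν : ℂ) * ((y ^ ν * Real.exp (-(ρ * y)) : ℝ) : ℂ)) +
        ∫ x in (-1 : ℝ)..1, (1 - (x + I)) ^ (ν : ℂ) * (1 + (x + I)) ^ (ν : ℂ) *
          exp ((ρ : ℂ) * I * (x + I)) := by
  set f : ℂ → ℂ := fun z => (1 - z) ^ (ν : ℂ) * (1 + z) ^ (ν : ℂ) * exp ((ρ : ℂ) * I * z) with hf
  have hνre : 0 < (ν : ℂ).re := by simpa using hν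
  have hcauchy := integral_boundary_rect_eq_zero_of_differentiable_on_off_countable f (-1) (1 + I)
    ∅ Set.countable_empty (by
      intro z hz
      simp [mem_reProdIm] at hz
      refine ContinuousAt.continuousWithinAt ?_
      refine ContinuousAt.mul (ContinuousAt.mul ?_ ?_) (by fun_prop)
      · exact ContinuousAt.comp (g := fun x : ℂ => x ^ (ν : ℂ)) (f := fun z : ℂ => 1 - z)
          (continuousAt_cpow_const_of_re_pos (Or.inl (by simp; linarith [hz.1.2])) hνre)
          (by fun_prop)
      · exact ContinuousAt.comp (g := fun x : ℂ => x ^ (ν : ℂ)) (f := fun z : ℂ => 1 + z)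
          (continuousAt_cpow_const_of_re_pos (Or.inl (by simp; linarith [hz.1.1])) hνre)
          (by fun_prop)) (by
      intro z hz
      simp [mem_reProdIm] at hz
      refine DifferentiableAt.mul (DifferentiableAt.mul ?_ ?_) (by fun_prop)
      · exact DifferentiableAt.cpow (by fun_prop) (by fun_prop) (Or.inl (by simp; linarith [hz.1.2]))
      · exact DifferentiableAt.cpow (by fun_prop) (by fun_prop)
          (Or.inl (by simp; linarith [hz.1.1])))
  simp only [neg_re, one_re, add_re, I_re, add_zero, neg_im, one_im, neg_zero, add_im, I_im,
    zero_add, ofReal_zero, zero_mul, ofReal_one, one_mul, ofReal_neg, smul_eq_mul] at hcauchy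
  have hbot : ∫ x in (-1 : ℝ)..1, f x = poissonIntegral ν ρ := by
    refine intervalIntegral.integral_congr fun t ht => ?_
    rw [Set.uIcc_of_le (by norm_num)] at ht
    simp only [hf]
    have e1 : (1 - (t : ℂ)) = ((1 - t : ℝ) : ℂ) := by push_cast; ring
    have e2 : (1 + (t : ℂ)) = ((1 + t : ℝ) : ℂ) := by push_cast; ring
    rw [e1, e2, ← ofReal_cpow (by linarith [ht.2]), ← ofReal_cpow (by linarith [ht.1]),
      ← ofReal_mul, ← Real.mul_rpow (by linarith [ht.2]) (by linarith [ht.1])]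
    congr 2
    · congr 2; ring
    · push_cast; ring
  have hexp : ∀ (y : ℝ) (s : ℂ), exp ((ρ : ℂ) * I * (s + y * I)) =
      exp ((ρ : ℂ) * I * s) * ((Real.exp (-(ρ * y)) : ℝ) : ℂ) := by
    intro y s
    rw [ofReal_exp, ← exp_add]
    congr 1
    push_cast
    linear_combination (ρ : ℂ) * y * I_sq
  have hright : ∫ y in (0 : ℝ)..1, f (1 + y * I) = (-I) ^ (ν : ℂ) * exp ((ρ : ℂ) * I) *
      ∫ y in (0 : ℝ)..1, (2 + y * I) ^ (ν : ℂ) * ((y ^ ν * Real.exp (-(ρ * y)) : ℝ) : ℂ) := by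
    rw [← intervalIntegral.integral_const_mul]
    refine intervalIntegral.integral_congr fun y hy => ?_
    rw [Set.uIcc_of_le zero_le_one] at hy
    simp only [hf]
    rw [hexp, show (1 - (1 + y * I)) = (y : ℂ) * -I by ring,
      ofReal_mul_cpow_ofReal hν hy.1 _ (neg_ne_zero.2 I_ne_zero),
      show 1 + (1 + y * I) = 2 + y * I by ring]
    push_cast
    ring_nf
  have hleft : ∫ y in (0 : ℝ)..1, f (-1 + y * I) = I ^ (ν : ℂ) * exp (-((ρ : ℂ) * I)) *
      ∫ y in (0 : ℝ)..1, (2 + y * -I) ^ (ν : ℂ) * ((y ^ ν * Real.exp (-(ρ * y)) : ℝ) : ℂ) := by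
    rw [← intervalIntegral.integral_const_mul]
    refine intervalIntegral.integral_congr fun y hy => ?_
    rw [Set.uIcc_of_le zero_le_one] at hy
    simp only [hf]
    rw [hexp, show (1 + (-1 + y * I)) = (y : ℂ) * I by ring,
      ofReal_mul_cpow_ofReal hν hy.1 _ I_ne_zero,
      show 1 - (-1 + y * I) = 2 + y * -I by ring, show (ρ : ℂ) * I * -1 = -((ρ : ℂ) * I) by ring]
    push_cast
    ring_nf
  rw [hbot, hright, hleft] at hcauchy
  linear_combination hcauchy

theorem exists_exp_neg_le_rpow (s : ℝ) :
    ∃ C : ℝ, 0 ≤ C ∧ ∀ ρ : ℝ, 1 ≤ ρ → Real.exp (-ρ) ≤ C * (1 / ρ) ^ s := by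
  have hO := (isLittleO_exp_neg_mul_rpow_atTop one_pos (-s)).isBigO
  obtain ⟨c, hc0, hc⟩ := hO.exists_nonneg
  rw [Asymptotics.isBigOWith_iff, Filter.eventually_atTop] at hc
  obtain ⟨R, hR⟩ := hc
  obtain ⟨B, hB⟩ := (isCompact_Icc (a := (1 : ℝ)) (b := max R 1)).exists_bound_of_continuousOn
    (f := fun ρ : ℝ => ρ ^ s) (fun ρ hρ => (Real.continuousAt_rpow_const ρ s
      (Or.inl (by linarith [hρ.1]))).continuousWithinAt)
  refine ⟨max c B, le_max_of_le_left hc0, fun ρ hρ => ?_⟩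
  have hρ0 : 0 < ρ := by linarith
  have hpos : 0 < ρ ^ s := Real.rpow_pos_of_pos hρ0 s
  rw [one_div, Real.inv_rpow hρ0.le]
  rcases le_total R ρ with h | h
  · have := hR ρ h
    rw [Real.norm_of_nonneg (by positivity), Real.norm_of_nonneg (by positivity),
      Real.rpow_neg hρ0.le, neg_one_mul] at this
    exact this.trans (mul_le_mul_of_nonneg_right (le_max_left _ _) (by positivity))
  · have h1 := hB ρ ⟨hρ, le_max_of_le_left h⟩
    rw [Real.norm_of_nonneg hpos.le] at h1
    have h2 : Real.exp (-ρ) ≤ 1 := Real.exp_le_one_iff.2 (by linarith)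
    refine h2.trans ?_
    rw [← div_eq_mul_inv, le_div_iff₀ hpos, one_mul]
    exact h1.trans (le_max_right _ _)

open Complex in
/-- Asymptotics of the Poisson integral, with an error term. -/
theorem exists_norm_poissonIntegral_sub_le {ν : ℝ} (hν : 0 < ν) :
    ∃ C : ℝ, ∀ ρ : ℝ, 1 ≤ ρ →
      ‖poissonIntegral ν ρ - ((2 * (2 ^ ν * Real.Gamma (ν + 1)) * (1 / ρ) ^ (ν + 1) *
        Real.cos (ρ - Real.pi * (ν + 1) / 2) : ℝ) : ℂ)‖ ≤ C * (1 / ρ) ^ (ν + 2) := by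
  have hνre : 0 < (ν : ℂ).re := by simpa using hν
  obtain ⟨B₁, hB₁⟩ := exists_norm_two_add_mul_cpow_sub_le ν (-I) (by simp)
  obtain ⟨B₂, hB₂⟩ := exists_norm_two_add_mul_cpow_sub_le ν I (by simp)
  obtain ⟨E, hE0, hE⟩ := exists_exp_neg_le_rpow (ν + 2)
  have hcont : ∀ w : ℂ, w.re = 0 →
      ContinuousOn (fun y : ℝ => (2 + y * w : ℂ) ^ (ν : ℂ)) (Set.Icc 0 1) := fun w hw =>
    (Continuous.cpow (by fun_prop) continuous_const (fun y => Or.inl (by simp [hw]))).continuousOn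
  obtain ⟨T, hT⟩ := isCompact_Icc.exists_bound_of_continuousOn (s := Set.Icc (-1 : ℝ) 1)
    (f := fun x : ℝ => (1 - (x + I)) ^ (ν : ℂ) * (1 + (x + I)) ^ (ν : ℂ)) (by
      refine ContinuousOn.mul ?_ ?_ <;> intro x hx
      · exact (ContinuousAt.comp (g := fun x : ℂ => x ^ (ν : ℂ)) (f := fun x : ℝ => 1 - (x + I))
          (continuousAt_cpow_const_of_re_pos (Or.inl (by simp; linarith [hx.2])) hνre)
          (by fun_prop)).continuousWithinAt
      · exact (ContinuousAt.comp (g := fun x : ℂ => x ^ (ν : ℂ)) (f := fun x : ℝ => 1 + (x + I))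
          (continuousAt_cpow_const_of_re_pos (Or.inl (by simp; linarith [hx.1])) hνre)
          (by fun_prop)).continuousWithinAt)
  have hT0 : 0 ≤ T := (norm_nonneg _).trans (hT 0 (by simp))
  set a : ℂ := (((2 : ℝ) ^ ν : ℝ) : ℂ) with ha
  refine ⟨(B₁ + ‖a‖) * Real.Gamma (ν + 2) + (B₂ + ‖a‖) * Real.Gamma (ν + 2) + T * E * 2,
    fun ρ hρ => ?_⟩
  have hρ0 : 0 < ρ := by linarith
  have h1 := norm_integral_rpow_mul_exp_sub_le hν _ a B₁ (hcont (-I) (by simp)) hB₁ hρ0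
  have h2 := norm_integral_rpow_mul_exp_sub_le hν _ a B₂ (hcont I (by simp)) hB₂ hρ0
  have h3 : ‖∫ x in (-1 : ℝ)..1, (1 - (x + I)) ^ (ν : ℂ) * (1 + (x + I)) ^ (ν : ℂ) *
      exp ((ρ : ℂ) * I * (x + I))‖ ≤ T * E * (1 / ρ) ^ (ν + 2) * |1 - (-1)| := by
    refine intervalIntegral.norm_integral_le_of_norm_le_const fun x hx => ?_
    rw [Set.uIoc_of_le (by norm_num)] at hx
    have hn : ‖exp ((ρ : ℂ) * I * (x + I))‖ = Real.exp (-ρ) := by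
      rw [norm_exp]
      simp
    rw [norm_mul, hn, mul_assoc]
    exact mul_le_mul (hT x ⟨hx.1.le, hx.2⟩) (hE ρ hρ) (Real.exp_pos _).le hT0
  rw [poissonIntegral_eq_contour hν]
  set I₁ := ∫ y in (0 : ℝ)..1, (2 + y * -I) ^ (ν : ℂ) * ((y ^ ν * Real.exp (-(ρ * y)) : ℝ) : ℂ)
  set I₂ := ∫ y in (0 : ℝ)..1, (2 + y * I) ^ (ν : ℂ) * ((y ^ ν * Real.exp (-(ρ * y)) : ℝ) : ℂ)
  set I₃ := ∫ x in (-1 : ℝ)..1, (1 - (x + I)) ^ (ν : ℂ) * (1 + (x + I)) ^ (ν : ℂ) *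
      exp ((ρ : ℂ) * I * (x + I))
  set G : ℂ := a * (((1 / ρ) ^ (ν + 1) * Real.Gamma (ν + 1) : ℝ) : ℂ) with hG
  set u₁ : ℂ := I * I ^ (ν : ℂ) * exp (-((ρ : ℂ) * I)) with hu₁
  set u₂ : ℂ := (-I) * (-I) ^ (ν : ℂ) * exp ((ρ : ℂ) * I) with hu₂
  have hu₁' : u₁ = exp (((-(ρ - Real.pi * (ν + 1) / 2) : ℝ) : ℂ) * I) := by
    rw [hu₁, cpow_def_of_ne_zero I_ne_zero, log_I]
    nth_rewrite 1 [← exp_pi_div_two_mul_I]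
    rw [← exp_add, ← exp_add]
    congr 1
    push_cast
    ring
  have hu₂' : u₂ = exp (((ρ - Real.pi * (ν + 1) / 2 : ℝ) : ℂ) * I) := by
    rw [hu₂, cpow_def_of_ne_zero (neg_ne_zero.2 I_ne_zero), log_neg_I]
    nth_rewrite 1 [← exp_neg_pi_div_two_mul_I]
    rw [← exp_add, ← exp_add]
    congr 1
    push_cast
    ring
  have hn₁ : ‖u₁‖ = 1 := by rw [hu₁', norm_exp_ofReal_mul_I]
  have hn₂ : ‖u₂‖ = 1 := by rw [hu₂', norm_exp_ofReal_mul_I]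
  have hmain : ((2 * (2 ^ ν * Real.Gamma (ν + 1)) * (1 / ρ) ^ (ν + 1) *
        Real.cos (ρ - Real.pi * (ν + 1) / 2) : ℝ) : ℂ) = u₁ * G + u₂ * G := by
    have hcos : ((Real.cos (ρ - Real.pi * (ν + 1) / 2) : ℝ) : ℂ) * 2 = u₁ + u₂ := by
      rw [hu₁', hu₂', ofReal_cos, cos, ofReal_neg]
      ring
    rw [← add_mul, ← hcos, hG, ha]
    simp only [ofReal_mul]
    push_cast
    ring
  have hsplit : u₁ * I₁ + u₂ * I₂ + I₃ - (u₁ * G + u₂ * G) =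
      u₁ * (I₁ - G) + u₂ * (I₂ - G) + I₃ := by ring
  rw [hmain, hsplit]
  calc _ ≤ ‖u₁ * (I₁ - G)‖ + ‖u₂ * (I₂ - G)‖ + ‖I₃‖ := norm_add₃_le
    _ ≤ (B₁ + ‖a‖) * ((1 / ρ) ^ (ν + 2) * Real.Gamma (ν + 2)) +
        (B₂ + ‖a‖) * ((1 / ρ) ^ (ν + 2) * Real.Gamma (ν + 2)) +
        T * E * (1 / ρ) ^ (ν + 2) * |1 - (-1)| := by
        rw [norm_mul u₁, norm_mul u₂, hn₁, hn₂, one_mul, one_mul]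
        exact add_le_add (add_le_add h1 h2) h3
    _ = _ := by
        norm_num
        ring

theorem abs_cos_le_of_two_angles (θ ρ : ℝ) :
    |Real.cos θ| ≤ |Real.cos (2 * ρ - θ)| + 4 * |Real.cos (ρ - θ)| := by
  have h : Real.cos (2 * ρ - θ) = (2 * Real.cos (ρ - θ) ^ 2 - 1) * Real.cos θ -
      2 * Real.sin (ρ - θ) * Real.cos (ρ - θ) * Real.sin θ := by
    rw [show 2 * ρ - θ = 2 * (ρ - θ) + θ by ring, Real.cos_add, Real.cos_two_mul, Real.sin_two_mul]
  set a := Real.cos (ρ - θ)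
  set b := Real.cos (2 * ρ - θ)
  have h2 : Real.cos θ = -b + (2 * a * Real.cos θ - 2 * Real.sin (ρ - θ) * Real.sin θ) * a := by
    rw [h]; ring
  have ha : |a| ≤ 1 := Real.abs_cos_le_one _
  have hb : |2 * a * Real.cos θ - 2 * Real.sin (ρ - θ) * Real.sin θ| ≤ 4 := by
    have e1 : |a * Real.cos θ| ≤ 1 := by
      rw [abs_mul]; exact mul_le_one₀ ha (abs_nonneg _) (Real.abs_cos_le_one _)
    have e2 : |Real.sin (ρ - θ) * Real.sin θ| ≤ 1 := by
      rw [abs_mul]; exact mul_le_one₀ (Real.abs_sin_le_one _) (abs_nonneg _) (Real.abs_sin_le_one _)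
    rw [abs_le] at *
    constructor <;> linarith [e1.1, e1.2, e2.1, e2.2]
  rw [h2]
  refine (abs_add_le _ _).trans ?_
  rw [abs_neg, abs_mul]
  exact add_le_add le_rfl (mul_le_mul_of_nonneg_right hb (abs_nonneg _))

/-- The Poisson integral cannot be small at both `ρ` and `2ρ` when `ρ` is large. -/
theorem exists_le_sq_norm_poissonIntegral {ν : ℝ} (hν : 0 < ν)
    (hcos : Real.cos (Real.pi * (ν + 1) / 2) ≠ 0) :
    ∃ K c : ℝ, 1 ≤ K ∧ 0 < c ∧ ∀ ρ : ℝ, K ≤ ρ →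
      c * (1 / ρ) ^ (2 * (ν + 1)) ≤
        ‖poissonIntegral ν ρ‖ ^ 2 + ‖poissonIntegral ν (2 * ρ)‖ ^ 2 := by
  obtain ⟨C, hC⟩ := exists_norm_poissonIntegral_sub_le hν
  have hC0 : 0 ≤ C := by simpa using (norm_nonneg _).trans (hC 1 le_rfl)
  set θ := Real.pi * (ν + 1) / 2
  set A := 2 * (2 ^ ν * Real.Gamma (ν + 1)) with hA
  have hA0 : 0 < A := by
    have := Real.Gamma_pos_of_pos (show 0 < ν + 1 by linarith)
    positivity
  set k := |Real.cos θ| with hk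
  have hk0 : 0 < k := abs_pos.2 hcos
  set q : ℝ := 2 ^ (ν + 1) with hq
  have hq0 : 0 < q := by positivity
  have hscaled : ∀ ρ : ℝ, 1 ≤ ρ →
      A * |Real.cos (ρ - θ)| ≤ ‖poissonIntegral ν ρ‖ * ρ ^ (ν + 1) + C / ρ := by
    intro ρ hρ
    have hρ0 : 0 < ρ := by linarith
    have h := hC ρ hρ
    have h1 : ‖((A * (1 / ρ) ^ (ν + 1) * Real.cos (ρ - θ) : ℝ) : ℂ)‖ ≤
        ‖poissonIntegral ν ρ‖ + C * (1 / ρ) ^ (ν + 2) := by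
      have := norm_sub_norm_le ((A * (1 / ρ) ^ (ν + 1) * Real.cos (ρ - θ) : ℝ) : ℂ)
        (poissonIntegral ν ρ)
      rw [norm_sub_rev] at this
      linarith
    have hp : 0 < ρ ^ (ν + 1) := by positivity
    rw [Complex.norm_real, Real.norm_eq_abs, abs_mul, abs_of_pos (show 0 < A * (1 / ρ) ^ (ν + 1) by
      positivity), show ν + 2 = ν + 1 + 1 by ring,
      Real.rpow_add_one (by positivity) (ν + 1), one_div, Real.inv_rpow hρ0.le] at h1
    have h2 := mul_le_mul_of_nonneg_right h1 hp.le
    set w := ρ ^ (ν + 1)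
    calc _ = A * w⁻¹ * |Real.cos (ρ - θ)| * w := by field_simp
      _ ≤ _ := h2
      _ = _ := by field_simp
  refine ⟨max 1 (10 * C / (A * k)), (A * k / 2) ^ 2 / (2 * (q ^ 2 + 16)), le_max_left _ _,
    by positivity, fun ρ hρ => ?_⟩
  have hρ1 : 1 ≤ ρ := (le_max_left _ _).trans hρ
  have hρ0 : 0 < ρ := by linarith
  have hρC : 10 * C / (A * k) ≤ ρ := (le_max_right _ _).trans hρ
  have hCρ : 5 * (C / ρ) ≤ A * k / 2 := by
    rw [div_le_iff₀ (by positivity)] at hρC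
    rw [← mul_div_assoc, div_le_iff₀ hρ0]
    linarith
  have e1 := hscaled ρ hρ1
  have e2 := hscaled (2 * ρ) (by linarith)
  have e3 := abs_cos_le_of_two_angles θ ρ
  have e4 : C / (2 * ρ) ≤ C / ρ := by gcongr; linarith
  rw [Real.mul_rpow zero_le_two hρ0.le] at e2
  set X := ‖poissonIntegral ν ρ‖
  set Y := ‖poissonIntegral ν (2 * ρ)‖
  set w := ρ ^ (ν + 1) with hw
  have hw0 : 0 < w := by positivity
  have e5 : A * k / 2 ≤ (q * Y + 4 * X) * w := by
    have := mul_le_mul_of_nonneg_left e3 hA0.le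
    nlinarith
  have e6 : (1 / ρ) ^ (2 * (ν + 1)) = 1 / w ^ 2 := by
    rw [one_div, Real.inv_rpow hρ0.le, mul_comm 2, Real.rpow_mul hρ0.le, one_div]
    simp [hw]
  rw [e6, mul_one_div, div_le_iff₀ (by positivity), div_le_iff₀ (by positivity)]
  have e7 : (A * k / 2) ^ 2 ≤ ((q * Y + 4 * X) * w) ^ 2 := by gcongr
  have e8 : (q * Y + 4 * X) ^ 2 ≤ (q ^ 2 + 16) * (X ^ 2 + Y ^ 2) := by
    nlinarith [sq_nonneg (q * X - 4 * Y)]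
  calc _ ≤ ((q * Y + 4 * X) * w) ^ 2 := e7
    _ = (q * Y + 4 * X) ^ 2 * w ^ 2 := by ring
    _ ≤ (q ^ 2 + 16) * (X ^ 2 + Y ^ 2) * w ^ 2 := by gcongr
    _ ≤ _ := by
        have : 0 ≤ (q ^ 2 + 16) * (X ^ 2 + Y ^ 2) * w ^ 2 := by positivity
        linarith

/-- The Fourier transform of the ball of radius `s` centred at the origin. -/
noncomputable def ballFourier {d : ℕ} (s : ℝ) (ξ : EuclideanSpace ℝ (Fin d)) : ℂ :=
  ∫ x in Metric.ball (0 : EuclideanSpace ℝ (Fin d)) s, torusChar (-inner ℝ ξ x)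

theorem ballFourier_eq_of_norm_eq {d : ℕ} (s : ℝ) {ξ η : EuclideanSpace ℝ (Fin d)}
    (h : ‖ξ‖ = ‖η‖) : ballFourier s ξ = ballFourier s η := by
  let R : EuclideanSpace ℝ (Fin d) ≃ₗᵢ[ℝ] EuclideanSpace ℝ (Fin d) :=
    (Submodule.span ℝ {ξ - η})ᗮ.reflection
  have hR : R ξ = η := Submodule.reflection_sub h
  have hpre : R ⁻¹' Metric.ball 0 s = Metric.ball 0 s := by
    ext x
    simp
  have := R.measurePreserving.setIntegral_preimage_emb R.toHomeomorph.measurableEmbedding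
    (fun x => torusChar (-inner ℝ η x)) (Metric.ball 0 s)
  rw [hpre] at this
  rw [ballFourier, ballFourier, ← this]
  refine integral_congr_ae (Filter.Eventually.of_forall fun x => ?_)
  simp only
  rw [← hR, R.inner_map_map]

theorem ballFourier_eq_smul {d : ℕ} {s : ℝ} (hs : 0 < s) (ξ : EuclideanSpace ℝ (Fin d)) :
    ballFourier s ξ = (s ^ d : ℝ) * ballFourier 1 (s • ξ) := by
  have h := Measure.setIntegral_comp_smul_of_pos
    (volume : Measure (EuclideanSpace ℝ (Fin d))) (fun x => torusChar (-inner ℝ ξ x))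
    (Metric.ball 0 1) hs
  rw [smul_unitBall_of_pos hs, finrank_euclideanSpace_fin] at h
  have hpos : ((s ^ d : ℝ) : ℂ) ≠ 0 := by exact_mod_cast (pow_pos hs d).ne'
  simp only [real_inner_smul_right] at h
  rw [ballFourier, ballFourier]
  simp only [real_inner_smul_left]
  rw [h, Complex.real_smul, ← mul_assoc, ← Complex.ofReal_mul, mul_inv_cancel₀ (pow_pos hs d).ne',
    Complex.ofReal_one, one_mul]

/-- Integration over the unit ball of a function of the first coordinate. -/
theorem setIntegral_ball_coord_zero {n : ℕ} (hn : 0 < n) (φ : ℝ → ℂ) (hφ : Continuous φ) :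
    ∫ x in Metric.ball (0 : EuclideanSpace ℝ (Fin (n + 1))) 1, φ (x 0) =
      ((volume.real (Metric.ball (0 : EuclideanSpace ℝ (Fin n)) 1) : ℝ) : ℂ) *
        ∫ t in (-1 : ℝ)..1, (((1 - t ^ 2) ^ ((n : ℝ) / 2) : ℝ) : ℂ) * φ t := by
  have : Nonempty (Fin n) := ⟨⟨0, hn⟩⟩
  let Ψ : EuclideanSpace ℝ (Fin (n + 1)) ≃ᵐ ℝ × EuclideanSpace ℝ (Fin n) :=
    ((MeasurableEquiv.toLp 2 (Fin (n + 1) → ℝ)).symm.trans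
      (MeasurableEquiv.piFinSuccAbove (fun _ => ℝ) 0)).trans
      ((MeasurableEquiv.refl ℝ).prodCongr (MeasurableEquiv.toLp 2 (Fin n → ℝ)))
  have hΨ : MeasurePreserving Ψ :=
    ((MeasurePreserving.id volume).prod (PiLp.volume_preserving_toLp (Fin n))).comp
      ((volume_preserving_piFinSuccAbove (fun _ => ℝ) 0).comp
        (EuclideanSpace.volume_preserving_symm_measurableEquiv_toLp (Fin (n + 1))))
  let S : Set (ℝ × EuclideanSpace ℝ (Fin n)) := {q | q.1 ^ 2 + ‖q.2‖ ^ 2 < 1}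
  have hSmeas : MeasurableSet S :=
    (isOpen_lt (by fun_prop) continuous_const).measurableSet
  have hpre : Ψ ⁻¹' S = Metric.ball 0 1 := by
    ext x
    have h1 : ‖x‖ ^ 2 = x 0 ^ 2 + ‖(Ψ x).2‖ ^ 2 := by
      rw [EuclideanSpace.real_norm_sq_eq, EuclideanSpace.real_norm_sq_eq, Fin.sum_univ_succ]
      rfl
    have h2 : (Ψ x).1 = x 0 := rfl
    rw [Set.mem_preimage, Set.mem_ofPred_eq, h2, ← h1, mem_ball_zero_iff]
    exact sq_lt_one_iff₀ (norm_nonneg x)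
  have hvolS : volume S < ⊤ := by
    rw [← hΨ.measure_preimage_equiv S, hpre]
    exact measure_ball_lt_top
  have h1 := hΨ.setIntegral_preimage_emb Ψ.measurableEmbedding (fun q => φ q.1) S
  rw [hpre] at h1
  have h2 : ∫ x in Metric.ball (0 : EuclideanSpace ℝ (Fin (n + 1))) 1, φ (x 0) =
      ∫ q in S, φ q.1 := h1
  obtain ⟨B, hB⟩ := (isCompact_Icc (a := (-1 : ℝ)) (b := 1)).exists_bound_of_continuousOn
    hφ.continuousOn
  have hint : IntegrableOn (fun q : ℝ × EuclideanSpace ℝ (Fin n) => φ q.1) S := by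
    refine Measure.integrableOn_of_bounded (M := B) hvolS.ne
      (hφ.comp continuous_fst).aestronglyMeasurable ?_
    refine (ae_restrict_iff' hSmeas).2 (Filter.Eventually.of_forall fun q hq => hB _ ?_)
    have hq : q.1 ^ 2 + ‖q.2‖ ^ 2 < 1 := hq
    constructor <;> nlinarith [sq_nonneg ‖q.2‖]
  have hslice : ∀ t : ℝ, ∫ y, S.indicator (fun q => φ q.1) (t, y) =
      (volume.real {y : EuclideanSpace ℝ (Fin n) | t ^ 2 + ‖y‖ ^ 2 < 1} : ℂ) * φ t := by
    intro t
    have : ∀ y, S.indicator (fun q => φ q.1) (t, y) =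
        {y : EuclideanSpace ℝ (Fin n) | t ^ 2 + ‖y‖ ^ 2 < 1}.indicator (fun _ => φ t) y := by
      intro y
      rfl
    simp only [this]
    rw [integral_indicator (isOpen_lt (by fun_prop) continuous_const).measurableSet,
      setIntegral_const, Complex.real_smul]
  rw [h2, ← integral_indicator hSmeas, Measure.volume_eq_prod,
    integral_prod _ (by rw [← Measure.volume_eq_prod]; exact (integrable_indicator_iff hSmeas).2 hint)]
  simp only [hslice]
  rw [← setIntegral_eq_integral_of_forall_compl_eq_zero (s := Set.Ioc (-1 : ℝ) 1),
    intervalIntegral.integral_of_le (by norm_num), ← integral_const_mul]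
  · refine setIntegral_congr_fun measurableSet_Ioc fun t ht => ?_
    have ht2 : 0 ≤ 1 - t ^ 2 := by nlinarith [ht.1, ht.2]
    have hset : {y : EuclideanSpace ℝ (Fin n) | t ^ 2 + ‖y‖ ^ 2 < 1} =
        Metric.ball 0 (Real.sqrt (1 - t ^ 2)) := by
      ext y
      rw [Set.mem_ofPred_eq, mem_ball_zero_iff, Real.lt_sqrt (norm_nonneg y)]
      constructor <;> intro h <;> linarith
    have hvol : volume.real (Metric.ball (0 : EuclideanSpace ℝ (Fin n)) (Real.sqrt (1 - t ^ 2))) =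
        (1 - t ^ 2) ^ ((n : ℝ) / 2) *
          volume.real (Metric.ball (0 : EuclideanSpace ℝ (Fin n)) 1) := by
      rw [Measure.real, Measure.addHaar_ball _ _ (Real.sqrt_nonneg _), ENNReal.toReal_mul,
        ENNReal.toReal_ofReal (by positivity), finrank_euclideanSpace_fin, Real.sqrt_eq_rpow,
        ← Real.rpow_natCast, ← Real.rpow_mul ht2, Measure.real]
      congr 2
      ring
    simp only [hset, hvol]
    push_cast
    ring
  · intro t ht
    have hset : {y : EuclideanSpace ℝ (Fin n) | t ^ 2 + ‖y‖ ^ 2 < 1} = ∅ := by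
      rw [Set.eq_empty_iff_forall_notMem]
      intro y hy
      have hy : t ^ 2 + ‖y‖ ^ 2 < 1 := hy
      refine ht ⟨?_, ?_⟩ <;> nlinarith [sq_nonneg ‖y‖]
    simp [hset]

theorem ballFourier_one_eq {n : ℕ} (hn : 0 < n) (ξ : EuclideanSpace ℝ (Fin (n + 1))) :
    ballFourier 1 ξ = ((volume.real (Metric.ball (0 : EuclideanSpace ℝ (Fin n)) 1) : ℝ) : ℂ) *
      poissonIntegral ((n : ℝ) / 2) (2 * Real.pi * ‖ξ‖) := by
  have hnorm : ‖ξ‖ = ‖EuclideanSpace.single (0 : Fin (n + 1)) (-‖ξ‖)‖ := by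
    simp
  rw [ballFourier_eq_of_norm_eq 1 hnorm, ballFourier]
  simp only [EuclideanSpace.inner_single_left]
  rw [setIntegral_ball_coord_zero hn (fun t => torusChar (-((starRingEnd ℝ) (-‖ξ‖) * t)))
    (continuous_torusChar.comp (by fun_prop)), poissonIntegral]
  congr 1
  refine intervalIntegral.integral_congr fun t _ => ?_
  simp only [torusChar]
  congr 3
  simp
  ring

theorem cos_pi_mul_succ_div_four_ne_zero {d : ℕ} (hd4 : d % 4 ≠ 1) :
    Real.cos (Real.pi * (d + 1) / 4) ≠ 0 := by
  rw [Real.cos_ne_zero_iff]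
  intro k hk
  have h1 : ((d : ℝ) + 1) = 2 * (2 * k + 1) := by
    have := Real.pi_ne_zero
    field_simp at hk
    linarith
  have h2 : (d : ℤ) + 1 = 2 * (2 * k + 1) := by exact_mod_cast h1
  omega

/-- The Fourier transforms of the balls of radii `s` and `2s` are not simultaneously small. -/
theorem exists_le_sq_norm_ballFourier {d : ℕ} (hd : 2 ≤ d) (hd4 : d % 4 ≠ 1) :
    ∃ K c : ℝ, 1 ≤ K ∧ 0 < c ∧ ∀ (s : ℝ) (ξ : EuclideanSpace ℝ (Fin d)), 0 < s → K ≤ s * ‖ξ‖ →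
      c * (s ^ d) ^ 2 * (1 / (s * ‖ξ‖)) ^ (d + 1) ≤
        ‖ballFourier s ξ‖ ^ 2 + ‖ballFourier (2 * s) ξ‖ ^ 2 := by
  obtain ⟨n, rfl⟩ : ∃ n, d = n + 1 := ⟨d - 1, by omega⟩
  have hn : 0 < n := by omega
  have hn' : (0 : ℝ) < n := by exact_mod_cast hn
  obtain ⟨K, c, hK, hc, h⟩ := exists_le_sq_norm_poissonIntegral (ν := (n : ℝ) / 2) (by positivity)
    (by
      have := cos_pi_mul_succ_div_four_ne_zero hd4
      convert this using 2
      push_cast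
      ring)
  set V := volume.real (Metric.ball (0 : EuclideanSpace ℝ (Fin n)) 1) with hV
  have hV0 : 0 < V := ENNReal.toReal_pos (Metric.measure_ball_pos _ _ one_pos).ne'
    measure_ball_lt_top.ne
  have hpi := Real.pi_pos
  refine ⟨K, c * V ^ 2 * (1 / (2 * Real.pi)) ^ (n + 2), hK, by positivity, fun s ξ hs hKs => ?_⟩
  have hnorm : ∀ a : ℝ, 0 < a → ‖ballFourier a ξ‖ =
      a ^ (n + 1) * (V * ‖poissonIntegral ((n : ℝ) / 2) (2 * Real.pi * (a * ‖ξ‖))‖) := by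
    intro a ha
    rw [ballFourier_eq_smul ha, ballFourier_one_eq hn, norm_mul, norm_mul, Complex.norm_real,
      Complex.norm_real, Real.norm_of_nonneg hV0.le, Real.norm_of_nonneg (by positivity), norm_smul,
      Real.norm_of_nonneg ha.le]
  have hρ : K ≤ 2 * Real.pi * (s * ‖ξ‖) := by nlinarith [Real.pi_gt_three]
  have h1 := h _ hρ
  rw [hnorm s hs, hnorm (2 * s) (by positivity),
    show 2 * Real.pi * (2 * s * ‖ξ‖) = 2 * (2 * Real.pi * (s * ‖ξ‖)) by ring]
  have hx0 : 0 < s * ‖ξ‖ := by linarith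
  have hexp : (1 / (2 * Real.pi * (s * ‖ξ‖))) ^ (2 * ((n : ℝ) / 2 + 1)) =
      (1 / (2 * Real.pi)) ^ (n + 2) * (1 / (s * ‖ξ‖)) ^ (n + 1 + 1) := by
    rw [show 2 * ((n : ℝ) / 2 + 1) = ((n + 2 : ℕ) : ℝ) by push_cast; ring, Real.rpow_natCast,
      ← mul_pow]
    congr 1
    field_simp
  rw [hexp] at h1
  set X := ‖poissonIntegral ((n : ℝ) / 2) (2 * Real.pi * (s * ‖ξ‖))‖
  set Y := ‖poissonIntegral ((n : ℝ) / 2) (2 * (2 * Real.pi * (s * ‖ξ‖)))‖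
  have h2 : s ^ (n + 1) ≤ (2 * s) ^ (n + 1) := by gcongr; linarith
  calc _ = (s ^ (n + 1)) ^ 2 * V ^ 2 *
        (c * ((1 / (2 * Real.pi)) ^ (n + 2) * (1 / (s * ‖ξ‖)) ^ (n + 1 + 1))) := by ring
    _ ≤ (s ^ (n + 1)) ^ 2 * V ^ 2 * (X ^ 2 + Y ^ 2) := by gcongr
    _ = (s ^ (n + 1) * (V * X)) ^ 2 + (s ^ (n + 1) * (V * Y)) ^ 2 := by ring
    _ ≤ _ := by gcongr

/-- An integer vector as a point of Euclidean space. -/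
noncomputable def intVec {d : ℕ} (m : Fin d → ℤ) : EuclideanSpace ℝ (Fin d) :=
  WithLp.toLp 2 fun i => (m i : ℝ)

/-- The point `z / M` of the grid `M⁻¹ ℤ^d`. -/
noncomputable def gridPoint {d : ℕ} (M : ℕ) (z : Fin d → ℤ) : EuclideanSpace ℝ (Fin d) :=
  WithLp.toLp 2 fun i => (z i : ℝ) / M

/-- The index of the grid cell that contains `x`. -/
noncomputable def gridFloor {d : ℕ} (M : ℕ) (x : EuclideanSpace ℝ (Fin d)) : Fin d → ℤ :=
  fun i => ⌊(M : ℝ) * x i⌋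

theorem inner_intVec {d : ℕ} (m : Fin d → ℤ) (x : EuclideanSpace ℝ (Fin d)) :
    inner ℝ (intVec m) x = ∑ i, (m i : ℝ) * x i := by
  rw [PiLp.inner_apply]
  exact Finset.sum_congr rfl fun i _ => by simp [intVec, mul_comm]

theorem measurable_gridFloor {d : ℕ} (M : ℕ) :
    Measurable (gridFloor M : EuclideanSpace ℝ (Fin d) → Fin d → ℤ) := by
  refine measurable_pi_lambda _ fun i => ?_
  exact Int.measurable_floor.comp (by fun_prop)

theorem norm_sub_gridPoint_gridFloor_le {d M : ℕ} (hM : 0 < M) (x : EuclideanSpace ℝ (Fin d)) :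
    ‖x - gridPoint M (gridFloor M x)‖ ≤ Real.sqrt d / M := by
  have hM' : (0 : ℝ) < M := by exact_mod_cast hM
  rw [EuclideanSpace.norm_eq]
  have : Real.sqrt d / M = Real.sqrt (∑ _i : Fin d, (1 / (M : ℝ)) ^ 2) := by
    rw [Finset.sum_const, Finset.card_univ, Fintype.card_fin, nsmul_eq_mul,
      Real.sqrt_mul (Nat.cast_nonneg d), Real.sqrt_sq (by positivity)]
    ring
  rw [this]
  refine Real.sqrt_le_sqrt (Finset.sum_le_sum fun i _ => ?_)
  have h1 := Int.floor_le ((M : ℝ) * x i)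
  have h2 := Int.lt_floor_add_one ((M : ℝ) * x i)
  have h3 : (x - gridPoint M (gridFloor M x)) i = (M * x i - ⌊(M : ℝ) * x i⌋) / M := by
    simp only [PiLp.sub_apply, gridPoint, gridFloor]
    field_simp
  rw [h3, Real.norm_eq_abs, sq_abs, div_pow, div_pow, one_pow]
  gcongr
  nlinarith

theorem gridFloor_add_gridPoint {d M : ℕ} (hM : 0 < M) (x : EuclideanSpace ℝ (Fin d))
    (z : Fin d → ℤ) : gridFloor M (x + gridPoint M z) = gridFloor M x + z := by
  have hM' : (M : ℝ) ≠ 0 := by positivity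
  funext i
  simp only [gridFloor, gridPoint, PiLp.add_apply, Pi.add_apply]
  rw [mul_add, mul_div_cancel₀ _ hM', Int.floor_add_intCast]

theorem measureReal_cell_zero {d M : ℕ} (hM : 0 < M) :
    volume.real (gridFloor M ⁻¹' {0} : Set (EuclideanSpace ℝ (Fin d))) = (1 / (M : ℝ)) ^ d := by
  have hM' : (0 : ℝ) < M := by exact_mod_cast hM
  have hset : (gridFloor M ⁻¹' {0} : Set (EuclideanSpace ℝ (Fin d))) =
      (WithLp.ofLp : EuclideanSpace ℝ (Fin d) → Fin d → ℝ) ⁻¹'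
        (Set.univ.pi fun _ => Set.Ico (0 : ℝ) (1 / M)) := by
    ext x
    simp only [Set.mem_preimage, Set.mem_singleton_iff, funext_iff, gridFloor, Pi.zero_apply,
      Set.mem_univ_pi, Set.mem_Ico, Int.floor_eq_zero_iff]
    refine forall_congr' fun i => and_congr ?_ ?_
    · exact mul_nonneg_iff_of_pos_left hM'
    · rw [lt_div_iff₀ hM', mul_comm]
  rw [hset, Measure.real, (PiLp.volume_preserving_ofLp (Fin d)).measure_preimage
    (MeasurableSet.univ_pi fun _ => measurableSet_Ico).nullMeasurableSet, volume_pi_pi]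
  simp [Real.volume_Ico]

/-- The integral of a character over the grid cell at the origin. -/
noncomputable def cellFourier {d : ℕ} (M : ℕ) (ξ : EuclideanSpace ℝ (Fin d)) : ℂ :=
  ∫ x in gridFloor M ⁻¹' {0}, torusChar (-inner ℝ ξ x)

theorem norm_cellFourier_le {d M : ℕ} (hM : 0 < M) (ξ : EuclideanSpace ℝ (Fin d)) :
    ‖cellFourier M ξ‖ ≤ (1 / (M : ℝ)) ^ d := by
  rw [← measureReal_cell_zero hM, ← one_mul (volume.real _)]
  refine norm_setIntegral_le_of_norm_le_const ?_ fun x _ => (norm_torusChar _).le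
  by_contra h
  have h2 := measureReal_cell_zero (d := d) hM
  rw [Measure.real, not_lt_top_iff.1 h] at h2
  have : (0 : ℝ) < (1 / (M : ℝ)) ^ d := by positivity
  simp at h2
  simp [← h2] at this

theorem setIntegral_cell_eq {d M : ℕ} (hM : 0 < M) (ξ : EuclideanSpace ℝ (Fin d))
    (z : Fin d → ℤ) :
    ∫ x in gridFloor M ⁻¹' {z}, torusChar (-inner ℝ ξ x) =
      torusChar (-inner ℝ ξ (gridPoint M z)) * cellFourier M ξ := by
  have h := (measurePreserving_add_right volume (gridPoint M z)).setIntegral_preimage_emb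
    (MeasurableEquiv.addRight (gridPoint M z)).measurableEmbedding
    (fun x => torusChar (-inner ℝ ξ x)) (gridFloor M ⁻¹' {z})
  have hpre : (fun x => x + gridPoint M z) ⁻¹' (gridFloor M ⁻¹' {z}) = gridFloor M ⁻¹' {0} := by
    ext x
    simp [gridFloor_add_gridPoint hM]
  rw [hpre] at h
  rw [← h, cellFourier, ← integral_const_mul]
  refine integral_congr_ae (Filter.Eventually.of_forall fun x => ?_)
  simp only
  rw [← torusChar_add, inner_add_right]
  congr 1
  ring

theorem setIntegral_ball_eq {d : ℕ} (s : ℝ) (ξ p : EuclideanSpace ℝ (Fin d)) :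
    ∫ x in Metric.ball p s, torusChar (-inner ℝ ξ x) =
      torusChar (-inner ℝ ξ p) * ballFourier s ξ := by
  have h := (measurePreserving_add_right volume p).setIntegral_preimage_emb
    (MeasurableEquiv.addRight p).measurableEmbedding
    (fun x => torusChar (-inner ℝ ξ x)) (Metric.ball p s)
  have hpre : (fun x => x + p) ⁻¹' (Metric.ball p s) = Metric.ball 0 s := by
    ext x
    simp
  rw [hpre] at h
  rw [← h, ballFourier, ← integral_const_mul]
  refine integral_congr_ae (Filter.Eventually.of_forall fun x => ?_)
  simp only
  rw [← torusChar_add, inner_add_right]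
  congr 1
  ring

theorem measureReal_annulus_le {d : ℕ} (hd : 0 < d) (p : EuclideanSpace ℝ (Fin d)) {s δ : ℝ}
    (hδ : 0 ≤ δ) (hδs : δ ≤ s) :
    volume.real (Metric.ball p (s + δ) \ Metric.ball p (s - δ)) ≤
      volume.real (Metric.ball (0 : EuclideanSpace ℝ (Fin d)) 1) *
        (2 * δ * d * (2 * s) ^ (d - 1)) := by
  have : Nonempty (Fin d) := ⟨⟨0, hd⟩⟩
  have hvol : ∀ t : ℝ, 0 ≤ t → volume.real (Metric.ball p t) =
      t ^ d * volume.real (Metric.ball (0 : EuclideanSpace ℝ (Fin d)) 1) := by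
    intro t ht
    rw [Measure.real, Measure.addHaar_ball _ _ ht, ENNReal.toReal_mul,
      ENNReal.toReal_ofReal (by positivity), finrank_euclideanSpace_fin, Measure.real]
  rw [measureReal_sdiff (Metric.ball_subset_ball (by linarith)) measurableSet_ball
    measure_ball_lt_top.ne, hvol _ (by linarith), hvol _ (by linarith), ← sub_mul, mul_comm]
  refine mul_le_mul_of_nonneg_left ?_ measureReal_nonneg
  refine (le_abs_self _).trans ((abs_pow_sub_pow_le _ _ _).trans ?_)
  rw [abs_of_nonneg (by linarith : 0 ≤ s + δ - (s - δ)), abs_of_nonneg (by linarith : 0 ≤ s + δ),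
    abs_of_nonneg (by linarith : 0 ≤ s - δ), max_eq_left (by linarith)]
  rw [show s + δ - (s - δ) = 2 * δ by ring]
  gcongr <;> linarith

/-- A character sum over the grid points in a ball approximates the Fourier transform. -/
theorem norm_cellFourier_mul_sum_sub_le {d M : ℕ} (hd : 0 < d) (hM : 0 < M) {s : ℝ}
    (hs : Real.sqrt d / M ≤ s) (ξ p : EuclideanSpace ℝ (Fin d)) (Z : Finset (Fin d → ℤ))
    (hZ : ∀ z, z ∈ Z ↔ ‖p - gridPoint M z‖ < s) :
    ‖cellFourier M ξ * (∑ z ∈ Z, torusChar (-inner ℝ ξ (gridPoint M z))) -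
        torusChar (-inner ℝ ξ p) * ballFourier s ξ‖ ≤
      volume.real (Metric.ball (0 : EuclideanSpace ℝ (Fin d)) 1) *
        (2 * (Real.sqrt d / M) * d * (2 * s) ^ (d - 1)) := by
  set δ := Real.sqrt d / M with hδ
  have hδ0 : 0 ≤ δ := by positivity
  set A : Set (EuclideanSpace ℝ (Fin d)) := gridFloor M ⁻¹' Z with hA
  set f : EuclideanSpace ℝ (Fin d) → ℂ := fun x => torusChar (-inner ℝ ξ x) with hf
  have hfc : Continuous f := continuous_torusChar.comp (by fun_prop)
  have hAmeas : MeasurableSet A := measurable_gridFloor M Z.countable_toSet.measurableSet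
  have hdist : ∀ x : EuclideanSpace ℝ (Fin d), |‖p - gridPoint M (gridFloor M x)‖ - dist x p| ≤ δ := by
    intro x
    refine le_trans ?_ (norm_sub_gridPoint_gridFloor_le hM x)
    rw [dist_comm, dist_eq_norm]
    refine (abs_norm_sub_norm_le _ _).trans (le_of_eq ?_)
    congr 1
    abel
  have hAsub : A ⊆ Metric.ball p (s + δ) := by
    intro x hx
    have := (hZ _).1 hx
    have h2 := abs_le.1 (hdist x)
    rw [Metric.mem_ball]
    linarith [h2.1]
  have hint : ∀ S ⊆ Metric.ball p (s + δ), IntegrableOn f S := by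
    intro S hS
    refine Measure.integrableOn_of_bounded (M := 1) ?_ hfc.aestronglyMeasurable
      (Filter.Eventually.of_forall fun x => (norm_torusChar _).le)
    exact ((measure_mono hS).trans_lt measure_ball_lt_top).ne
  have hAint : cellFourier M ξ * (∑ z ∈ Z, torusChar (-inner ℝ ξ (gridPoint M z))) =
      ∫ x in A, f x := by
    have hAU : A = ⋃ z ∈ Z, gridFloor M ⁻¹' {z} := by
      ext x
      simp [hA]
    rw [hAU, integral_biUnion_finset, mul_comm, Finset.sum_mul]
    · exact Finset.sum_congr rfl fun z _ => (setIntegral_cell_eq hM ξ z).symm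
    · exact fun z _ => measurable_gridFloor M (measurableSet_singleton z)
    · intro z _ z' _ hzz
      exact Disjoint.preimage _ (Set.disjoint_singleton.2 hzz)
    · intro z hz
      refine hint _ (Set.Subset.trans ?_ hAsub)
      exact Set.preimage_mono (Set.singleton_subset_iff.2 hz)
  have hBsub : Metric.ball p s ⊆ Metric.ball p (s + δ) := Metric.ball_subset_ball (by linarith)
  have hannmeas : MeasurableSet (Metric.ball p (s + δ) \ Metric.ball p (s - δ)) :=
    measurableSet_ball.diff measurableSet_ball
  rw [hAint, ← setIntegral_ball_eq, ← integral_indicator hAmeas,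
    ← integral_indicator measurableSet_ball, ← integral_sub
      ((integrable_indicator_iff hAmeas).2 (hint A hAsub))
      ((integrable_indicator_iff measurableSet_ball).2 (hint _ hBsub))]
  refine le_trans ?_ (measureReal_annulus_le hd p hδ0 hs)
  rw [← integral_indicator_one hannmeas]
  refine norm_integral_le_of_norm_le ?_ (Filter.Eventually.of_forall fun x => ?_)
  · refine (integrable_indicator_iff hannmeas).2 (integrableOn_const ?_)
    exact ((measure_mono Set.sdiff_subset).trans_lt measure_ball_lt_top).ne
  · have hmemA : x ∈ A ↔ ‖p - gridPoint M (gridFloor M x)‖ < s := hZ _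
    have hmemB : x ∈ Metric.ball p s ↔ dist x p < s := Metric.mem_ball
    have h2 := abs_le.1 (hdist x)
    have hfx : ‖f x‖ = 1 := norm_torusChar _
    have hmem : (x ∈ A ∧ x ∉ Metric.ball p s) ∨ (x ∉ A ∧ x ∈ Metric.ball p s) →
        x ∈ Metric.ball p (s + δ) \ Metric.ball p (s - δ) := by
      rw [hmemA, hmemB]
      simp only [Set.mem_sdiff, Metric.mem_ball, not_lt]
      rintro (⟨h3, h4⟩ | ⟨h3, h4⟩) <;> constructor <;> linarith [h2.1, h2.2]
    by_cases hxA : x ∈ A <;> by_cases hxB : x ∈ Metric.ball p s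
    · simp only [Set.indicator_of_mem hxA, Set.indicator_of_mem hxB, hf, sub_self, norm_zero]
      exact Set.indicator_nonneg (fun _ _ => zero_le_one) _
    · rw [Set.indicator_of_mem hxA, Set.indicator_of_notMem hxB, sub_zero, hfx,
        Set.indicator_of_mem (hmem (Or.inl ⟨hxA, hxB⟩))]
      rfl
    · rw [Set.indicator_of_notMem hxA, Set.indicator_of_mem hxB, zero_sub, norm_neg,
        Set.indicator_of_mem (hmem (Or.inr ⟨hxA, hxB⟩))]
      exact hfx.le
    · rw [Set.indicator_of_notMem hxA, Set.indicator_of_notMem hxB, sub_zero, norm_zero]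
      exact Set.indicator_nonneg (fun _ _ => zero_le_one) _

/-- The ball of radius `s` around `x`, made periodic with respect to `ℤ^d`. -/
def periodicBall {d : ℕ} (x : Fin d → ℝ) (s : ℝ) : Set (Fin d → ℝ) :=
  {y | ∃ mm : Fin d → ℤ, Real.sqrt (∑ i, (y i - x i - (mm i : ℝ)) ^ 2) < s}

theorem norm_toLp_sub_gridPoint {d : ℕ} (M : ℕ) (p : Fin d → ℝ) (z : Fin d → ℤ) :
    ‖WithLp.toLp 2 p - gridPoint M z‖ = Real.sqrt (∑ i, (p i - (z i : ℝ) / M) ^ 2) := by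
  rw [EuclideanSpace.norm_eq]
  simp [gridPoint, sq_abs]

theorem exists_finset_mem_iff_norm_sub_gridPoint_lt {d M : ℕ} (hM : 0 < M) (s : ℝ)
    (p : EuclideanSpace ℝ (Fin d)) :
    ∃ Z : Finset (Fin d → ℤ), ∀ z, z ∈ Z ↔ ‖p - gridPoint M z‖ < s := by
  classical
  have hM' : (0 : ℝ) < M := by exact_mod_cast hM
  refine ⟨(Fintype.piFinset fun i => Finset.Icc ⌊(M : ℝ) * (p i - s)⌋ ⌈(M : ℝ) * (p i + s)⌉).filter
    fun z => ‖p - gridPoint M z‖ < s, fun z => ?_⟩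
  rw [Finset.mem_filter, and_iff_right_iff_imp, Fintype.mem_piFinset]
  intro hz i
  have h1 := abs_lt.1 ((PiLp.norm_apply_le (p - gridPoint M z) i).trans_lt hz)
  simp only [PiLp.sub_apply, gridPoint] at h1
  have hzi : (z i : ℝ) = M * (z i / M) := by field_simp
  rw [Finset.mem_Icc]
  constructor
  · refine Int.floor_le_iff.2 ?_
    rw [hzi]
    nlinarith
  · refine Int.le_ceil_iff.2 ?_
    rw [hzi]
    nlinarith

theorem eq_of_norm_sub_gridPoint_lt_of_modEq {d M : ℕ} (hM : 0 < M) {s : ℝ} (hs : s ≤ 1 / 2)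
    (p : EuclideanSpace ℝ (Fin d)) {z z' : Fin d → ℤ} (hz : ‖p - gridPoint M z‖ < s)
    (hz' : ‖p - gridPoint M z'‖ < s) (h : ∀ i, z i ≡ z' i [ZMOD M]) : z = z' := by
  have hM' : (0 : ℝ) < M := by exact_mod_cast hM
  funext i
  obtain ⟨k, hk⟩ := (h i).dvd
  have h1 := (PiLp.norm_apply_le (p - gridPoint M z) i).trans_lt hz
  have h2 := (PiLp.norm_apply_le (p - gridPoint M z') i).trans_lt hz'
  simp only [PiLp.sub_apply, gridPoint, Real.norm_eq_abs] at h1 h2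
  have hk' : (z' i : ℝ) / M - z i / M = k := by
    have : (z' i : ℝ) - z i = M * k := by exact_mod_cast hk
    rw [← sub_div, this]
    field_simp
  have h3 : |(k : ℝ)| < 1 := by
    rw [abs_lt] at h1 h2 ⊢
    constructor <;> linarith [h1.1, h1.2, h2.1, h2.2]
  have : k = 0 := Int.abs_lt_one_iff.1 (by exact_mod_cast h3)
  rw [this, mul_zero] at hk
  linarith

/-- A character sum over the grid centers of periodic balls containing `p` is a sum over the
points of the full grid near `p`. -/
theorem sum_indicator_periodicBall_mul_torusChar {d M : ℕ} (hM : 0 < M) (a : ℤ) {s : ℝ}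
    (hs : s ≤ 1 / 2) (p : Fin d → ℝ) (m : Fin d → ℤ) (Z : Finset (Fin d → ℤ))
    (hZ : ∀ z, z ∈ Z ↔ ‖WithLp.toLp 2 p - gridPoint M z‖ < s) :
    ∑ j ∈ Fintype.piFinset fun _ : Fin d => Finset.Ico a (a + M),
        (((periodicBall (fun i => (j i : ℝ) / M) s).indicator (fun _ => (1 : ℝ)) p : ℝ) : ℂ) *
          torusChar (-∑ i, (m i : ℝ) * ((j i : ℝ) / M)) =
      ∑ z ∈ Z, torusChar (-inner ℝ (intVec m) (gridPoint M z)) := by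
  classical
  have hM' : (M : ℝ) ≠ 0 := by positivity
  have hMz : (0 : ℤ) < M := by exact_mod_cast hM
  have hlhs : ∀ j : Fin d → ℤ,
      (((periodicBall (fun i => (j i : ℝ) / M) s).indicator (fun _ => (1 : ℝ)) p : ℝ) : ℂ) *
          torusChar (-∑ i, (m i : ℝ) * ((j i : ℝ) / M)) =
        if p ∈ periodicBall (fun i => (j i : ℝ) / M) s then
          torusChar (-∑ i, (m i : ℝ) * ((j i : ℝ) / M)) else 0 := by
    intro j
    by_cases h : p ∈ periodicBall (fun i => (j i : ℝ) / M) s <;> simp [h]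
  rw [Finset.sum_congr rfl fun j _ => hlhs j, ← Finset.sum_filter]
  symm
  have hred : ∀ z : Fin d → ℤ, ∀ i, ∃ k : ℤ, z i = (a + (z i - a) % M) + M * k := fun z i =>
    ⟨(z i - a) / M, by linarith [Int.emod_add_mul_ediv (z i - a) M]⟩
  refine Finset.sum_bij (fun z _ i => a + (z i - a) % M) ?_ ?_ ?_ ?_
  · intro z hz
    rw [Finset.mem_filter, Fintype.mem_piFinset]
    refine ⟨fun i => ?_, ?_⟩
    · rw [Finset.mem_Ico]
      have h1 := Int.emod_nonneg (z i - a) hMz.ne'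
      have h2 := Int.emod_lt_of_pos (z i - a) hMz
      omega
    · rw [hZ, norm_toLp_sub_gridPoint] at hz
      choose k hk using hred z
      refine ⟨k, lt_of_eq_of_lt ?_ hz⟩
      congr 1
      refine Finset.sum_congr rfl fun i _ => ?_
      have : (z i : ℝ) = ((a + (z i - a) % M : ℤ) : ℝ) + M * k i := by exact_mod_cast hk i
      rw [this]
      field_simp
      ring
  · intro z hz z' hz' h
    refine eq_of_norm_sub_gridPoint_lt_of_modEq hM hs _ ((hZ z).1 hz) ((hZ z').1 hz') fun i => ?_
    have h1 := congrFun h i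
    have h2 : z i - a ≡ z' i - a [ZMOD M] := by
      unfold Int.ModEq
      omega
    simpa using h2.add_right a
  · intro j hj
    rw [Finset.mem_filter, Fintype.mem_piFinset] at hj
    obtain ⟨hj, mm, hmm⟩ := hj
    refine ⟨fun i => j i + M * mm i, ?_, ?_⟩
    · rw [hZ, norm_toLp_sub_gridPoint]
      refine lt_of_eq_of_lt ?_ hmm
      congr 1
      refine Finset.sum_congr rfl fun i _ => ?_
      push_cast
      field_simp
      ring
    · funext i
      have h1 := Finset.mem_Ico.1 (hj i)
      rw [show j i + M * mm i - a = j i - a + M * mm i by ring, Int.add_mul_emod_self_left,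
        Int.emod_eq_of_lt (by omega) (by omega)]
      ring
  · intro z hz
    choose k hk using hred z
    have h1 : -inner ℝ (intVec m) (gridPoint M z) =
        -(∑ i, (m i : ℝ) * (((a + (z i - a) % M : ℤ) : ℝ) / M)) + ((-∑ i, m i * k i : ℤ) : ℝ) := by
      rw [inner_intVec]
      push_cast
      rw [← neg_add, ← Finset.sum_add_distrib]
      congr 1
      refine Finset.sum_congr rfl fun i _ => ?_
      have : (z i : ℝ) = ((a + (z i - a) % M : ℤ) : ℝ) + M * k i := by exact_mod_cast hk i
      simp only [gridPoint]
      rw [this]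
      push_cast
      field_simp
    rw [h1, torusChar_add, torusChar_int, mul_one]

theorem norm_cellFourier_mul_sum_periodicBall_sub_le {d M : ℕ} (hd : 0 < d) (hM : 0 < M) (a : ℤ)
    {s : ℝ} (hs : Real.sqrt d / M ≤ s) (hs2 : s ≤ 1 / 2) (p : Fin d → ℝ) (m : Fin d → ℤ) :
    ‖cellFourier M (intVec m) * (∑ j ∈ Fintype.piFinset fun _ : Fin d => Finset.Ico a (a + M),
        (((periodicBall (fun i => (j i : ℝ) / M) s).indicator (fun _ => (1 : ℝ)) p : ℝ) : ℂ) *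
          torusChar (-∑ i, (m i : ℝ) * ((j i : ℝ) / M))) -
        torusChar (-∑ i, (m i : ℝ) * p i) * ballFourier s (intVec m)‖ ≤
      volume.real (Metric.ball (0 : EuclideanSpace ℝ (Fin d)) 1) *
        (2 * (Real.sqrt d / M) * d * (2 * s) ^ (d - 1)) := by
  obtain ⟨Z, hZ⟩ := exists_finset_mem_iff_norm_sub_gridPoint_lt hM s (WithLp.toLp 2 p)
  rw [sum_indicator_periodicBall_mul_torusChar hM a hs2 p m Z hZ]
  have := norm_cellFourier_mul_sum_sub_le hd hM hs (intVec m) (WithLp.toLp 2 p) Z hZ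
  rwa [inner_intVec m (WithLp.toLp 2 p)] at this

/-- The discrepancy of `p` with respect to the periodic ball of radius `s` around `x`. -/
noncomputable def ballDiscrepancy {d N : ℕ} (p : Fin N → Fin d → ℝ) (s : ℝ) (x : Fin d → ℝ) : ℝ :=
  ∑ n, (periodicBall x s).indicator (fun _ => (1 : ℝ)) (p n) -
    N * (volume (Metric.ball (0 : EuclideanSpace ℝ (Fin d)) s)).toReal

theorem norm_expSum_mul_ballFourier_le {d N M : ℕ} (hd : 0 < d) (hM : 0 < M) (a : ℤ)
    {s : ℝ} (hs : Real.sqrt d / M ≤ s) (hs2 : s ≤ 1 / 2) (p : Fin N → Fin d → ℝ)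
    (m : Fin d → ℤ) (hm : ∃ i, ¬ (M : ℤ) ∣ m i) :
    ‖expSum p m‖ * ‖ballFourier s (intVec m)‖ ≤
      (1 / (M : ℝ)) ^ d * ‖∑ j ∈ Fintype.piFinset fun _ : Fin d => Finset.Ico a (a + M),
        (ballDiscrepancy p s (fun i => (j i : ℝ) / M) : ℂ) *
          (starRingEnd ℂ) (torusChar (∑ i, (m i : ℝ) * ((j i : ℝ) / M)))‖ +
      N * (volume.real (Metric.ball (0 : EuclideanSpace ℝ (Fin d)) 1) *
        (2 * (Real.sqrt d / M) * d * (2 * s) ^ (d - 1))) := by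
  set J := Fintype.piFinset fun _ : Fin d => Finset.Ico a (a + M)
  set b : (Fin d → ℝ) → ℂ := fun y => ∑ j ∈ J,
    (((periodicBall (fun i => (j i : ℝ) / M) s).indicator (fun _ => (1 : ℝ)) y : ℝ) : ℂ) *
      torusChar (-∑ i, (m i : ℝ) * ((j i : ℝ) / M)) with hb
  set B := volume.real (Metric.ball (0 : EuclideanSpace ℝ (Fin d)) 1) *
    (2 * (Real.sqrt d / M) * d * (2 * s) ^ (d - 1))
  have hsum : ∑ j ∈ J, (ballDiscrepancy p s (fun i => (j i : ℝ) / M) : ℂ) *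
      (starRingEnd ℂ) (torusChar (∑ i, (m i : ℝ) * ((j i : ℝ) / M))) = ∑ n, b (p n) := by
    have h0 : ∑ j ∈ J, torusChar (-∑ i, (m i : ℝ) * ((j i : ℝ) / M)) = 0 := by
      simp only [torusChar_neg]
      rw [← map_sum, sum_grid_torusChar_eq_zero M a m hm, map_zero]
    simp only [← torusChar_neg, ballDiscrepancy, hb]
    rw [Finset.sum_comm]
    push_cast
    simp only [sub_mul]
    rw [Finset.sum_sub_distrib, ← Finset.mul_sum, h0, mul_zero, sub_zero]
    exact Finset.sum_congr rfl fun j _ => Finset.sum_mul _ _ _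
  have hchar : ∑ n, torusChar (-∑ i, (m i : ℝ) * p n i) = (starRingEnd ℂ) (expSum p m) := by
    simp only [torusChar_neg, expSum, map_sum]
  have hdiff : ‖cellFourier M (intVec m) * ∑ n, b (p n) -
      (starRingEnd ℂ) (expSum p m) * ballFourier s (intVec m)‖ ≤ N * B := by
    rw [← hchar, Finset.mul_sum, Finset.sum_mul, ← Finset.sum_sub_distrib]
    refine (norm_sum_le_of_le _ fun n _ =>
      norm_cellFourier_mul_sum_periodicBall_sub_le hd hM a hs hs2 (p n) m).trans ?_
    simp [B]
  rw [hsum]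
  calc ‖expSum p m‖ * ‖ballFourier s (intVec m)‖
      = ‖(starRingEnd ℂ) (expSum p m) * ballFourier s (intVec m)‖ := by
        rw [norm_mul, RCLike.norm_conj]
    _ ≤ ‖cellFourier M (intVec m) * ∑ n, b (p n)‖ + N * B := by
        refine le_trans ?_ (add_le_add_right hdiff _)
        exact norm_le_norm_add_norm_sub _ _
    _ ≤ _ := by
        rw [norm_mul]
        gcongr
        exact norm_cellFourier_le hM _

theorem sum_sq_norm_expSum_mul_ballFourier_le {d N M : ℕ} (hd : 0 < d) (hM : 0 < M) (a : ℤ)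
    {s : ℝ} (hs : Real.sqrt d / M ≤ s) (hs2 : s ≤ 1 / 2) (p : Fin N → Fin d → ℝ)
    (T : Finset (Fin d → ℤ)) (hT : ∀ m ∈ T, ∃ i, ¬ (M : ℤ) ∣ m i)
    (hTT : ∀ m ∈ T, ∀ m' ∈ T, m ≠ m' → ∃ i, ¬ (M : ℤ) ∣ m i - m' i) :
    ∑ m ∈ T, ‖expSum p m‖ ^ 2 * ‖ballFourier s (intVec m)‖ ^ 2 ≤
      2 * (1 / (M : ℝ) ^ d * ∑ j ∈ Fintype.piFinset fun _ : Fin d => Finset.Ico a (a + M),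
        ballDiscrepancy p s (fun i => (j i : ℝ) / M) ^ 2) +
      2 * (T.card * (N * (volume.real (Metric.ball (0 : EuclideanSpace ℝ (Fin d)) 1) *
        (2 * (Real.sqrt d / M) * d * (2 * s) ^ (d - 1)))) ^ 2) := by
  have hM' : (0 : ℝ) < M := by exact_mod_cast hM
  set J := Fintype.piFinset fun _ : Fin d => Finset.Ico a (a + M) with hJ
  set B := volume.real (Metric.ball (0 : EuclideanSpace ℝ (Fin d)) 1) *
    (2 * (Real.sqrt d / M) * d * (2 * s) ^ (d - 1)) with hB
  have hcard : (J.card : ℝ) = (M : ℝ) ^ d := by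
    simp [hJ]
  set α : (Fin d → ℤ) → ℝ := fun m => ‖∑ j ∈ J,
    (ballDiscrepancy p s (fun i => (j i : ℝ) / M) : ℂ) *
      (starRingEnd ℂ) (torusChar (∑ i, (m i : ℝ) * ((j i : ℝ) / M)))‖ with hα
  have hbessel : ∑ m ∈ T, α m ^ 2 ≤
      (M : ℝ) ^ d * ∑ j ∈ J, ballDiscrepancy p s (fun i => (j i : ℝ) / M) ^ 2 := by
    have := sum_sq_norm_sum_mul_conj_le J T
      (fun j => (ballDiscrepancy p s (fun i => (j i : ℝ) / M) : ℂ))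
      (fun m j => torusChar (∑ i, (m i : ℝ) * ((j i : ℝ) / M))) (fun _ _ => norm_torusChar _) ?_
    · rw [hcard] at this
      simpa [hα, sq_abs] using this
    · intro m hm m' hm' hne
      rw [← sum_grid_torusChar_eq_zero M a (m - m') (hTT m hm m' hm' hne)]
      refine Finset.sum_congr rfl fun j _ => ?_
      rw [← torusChar_sub, ← Finset.sum_sub_distrib]
      congr 1
      refine Finset.sum_congr rfl fun i _ => ?_
      simp [sub_mul]
  calc ∑ m ∈ T, ‖expSum p m‖ ^ 2 * ‖ballFourier s (intVec m)‖ ^ 2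
      ≤ ∑ m ∈ T, (2 * ((1 / (M : ℝ)) ^ d) ^ 2 * α m ^ 2 + 2 * (N * B) ^ 2) := by
        refine Finset.sum_le_sum fun m hm => ?_
        have h := norm_expSum_mul_ballFourier_le hd hM a hs hs2 p m (hT m hm)
        rw [← mul_pow]
        refine (pow_le_pow_left₀ (by positivity) h 2).trans ?_
        refine (add_sq_le).trans (le_of_eq ?_)
        rw [mul_add, mul_pow]
        ring
    _ = 2 * ((1 / (M : ℝ)) ^ d) ^ 2 * ∑ m ∈ T, α m ^ 2 + 2 * (T.card * (N * B) ^ 2) := by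
        rw [Finset.sum_add_distrib, ← Finset.mul_sum, Finset.sum_const, nsmul_eq_mul]
        ring
    _ ≤ 2 * ((1 / (M : ℝ)) ^ d) ^ 2 *
          ((M : ℝ) ^ d * ∑ j ∈ J, ballDiscrepancy p s (fun i => (j i : ℝ) / M) ^ 2) +
          2 * (T.card * (N * B) ^ 2) := by gcongr
    _ = _ := by
        congr 1
        rw [one_div_pow]
        field_simp

theorem abs_le_norm_intVec {d : ℕ} (m : Fin d → ℤ) (i : Fin d) : |(m i : ℝ)| ≤ ‖intVec m‖ :=
  PiLp.norm_apply_le (intVec m) i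

theorem norm_intVec_le {d : ℕ} (m : Fin d → ℤ) (L : ℕ) (h : ∀ i, |m i| ≤ L) :
    ‖intVec m‖ ≤ Real.sqrt d * L := by
  have : Real.sqrt d * L = Real.sqrt (∑ _i : Fin d, (L : ℝ) ^ 2) := by
    rw [Finset.sum_const, Finset.card_univ, Fintype.card_fin, nsmul_eq_mul,
      Real.sqrt_mul (Nat.cast_nonneg d), Real.sqrt_sq (by positivity)]
  rw [this, EuclideanSpace.norm_eq]
  refine Real.sqrt_le_sqrt (Finset.sum_le_sum fun i _ => ?_)
  have : |(m i : ℝ)| ≤ L := by exact_mod_cast h i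
  exact pow_le_pow_left₀ (norm_nonneg _) this 2

theorem card_filter_norm_intVec_lt_le {d : ℕ} (T : Finset (Fin d → ℤ)) {R : ℝ} (hR : 0 ≤ R) :
    ((T.filter fun m => ‖intVec m‖ < R).card : ℝ) ≤ (2 * R + 1) ^ d := by
  have hsub : (T.filter fun m => ‖intVec m‖ < R) ⊆
      Fintype.piFinset fun _ : Fin d => Finset.Icc (-⌊R⌋) ⌊R⌋ := by
    intro m hm
    rw [Fintype.mem_piFinset]
    intro i
    have h := abs_le.1 ((abs_le_norm_intVec m i).trans (Finset.mem_filter.1 hm).2.le)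
    have h1 : m i ≤ ⌊R⌋ := Int.le_floor.2 h.2
    have h2 : -m i ≤ ⌊R⌋ := Int.le_floor.2 (by push_cast; linarith [h.1])
    rw [Finset.mem_Icc]
    omega
  have hfl : 0 ≤ ⌊R⌋ := Int.floor_nonneg.2 hR
  calc ((T.filter fun m => ‖intVec m‖ < R).card : ℝ)
      ≤ ((Fintype.piFinset fun _ : Fin d => Finset.Icc (-⌊R⌋) ⌊R⌋).card : ℝ) := by
        exact_mod_cast Finset.card_le_card hsub
    _ = ((⌊R⌋ + 1 - -⌊R⌋ : ℤ) : ℝ) ^ d := by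
        rw [Fintype.card_piFinset_const, Int.card_Icc, Nat.cast_pow, ← Int.cast_natCast,
          Int.toNat_of_nonneg (by omega)]
    _ ≤ (2 * R + 1) ^ d := by
        have := Int.floor_le R
        have h0 : (0 : ℝ) ≤ ⌊R⌋ := by exact_mod_cast hfl
        push_cast
        gcongr <;> linarith

/-- The exponential sums of a finite sequence are large on average over the frequencies of a
translated cube, even when the frequencies of norm less than `R` are left out. -/
theorem exists_frequencies_le_sum_sq_norm_expSum {d N : ℕ} (p : Fin N → Fin d → ℝ) (L : ℕ)
    {R : ℝ} (hR : 0 ≤ R) (hRL : 2 * N * (2 * R + 1) ^ d ≤ ((L : ℝ) + 1) ^ d) :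
    ∃ T : Finset (Fin d → ℤ), (∀ m ∈ T, R ≤ ‖intVec m‖) ∧ (∀ m ∈ T, ∀ i, |m i| ≤ L) ∧
      (∀ m ∈ T, ∀ m' ∈ T, ∀ i, |m i - m' i| ≤ L) ∧ (T.card : ℝ) ≤ ((L : ℝ) + 1) ^ d ∧
      N * ((L : ℝ) + 1) ^ d / 2 ≤ ∑ m ∈ T, ‖expSum p m‖ ^ 2 := by
  classical
  set Q : Finset (Fin d → ℤ) := Fintype.piFinset fun _ => Finset.Icc 0 (L : ℤ) with hQ
  have hQcard : (Q.card : ℝ) = ((L : ℝ) + 1) ^ d := by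
    simp [hQ]
  have hQne : Q.Nonempty := ⟨0, by simp [hQ, Fintype.mem_piFinset]⟩
  obtain ⟨k', hk', hsum⟩ := exists_card_mul_le_sum_sq_norm_expSum p Q hQne
  have hinj : Set.InjOn (fun k : Fin d → ℤ => k - k') Q := fun x _ y _ h => sub_left_injective h
  set P := Q.image fun k => k - k' with hP
  have hPcard : (P.card : ℝ) = ((L : ℝ) + 1) ^ d := by
    rw [← hQcard, hP, Finset.card_image_of_injOn hinj]
  have hPsum : N * ((L : ℝ) + 1) ^ d ≤ ∑ m ∈ P, ‖expSum p m‖ ^ 2 := by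
    rw [hP, Finset.sum_image hinj, ← hQcard]
    exact hsum
  have hQmem : ∀ k ∈ Q, ∀ i, 0 ≤ k i ∧ k i ≤ L := fun k hk i =>
    Finset.mem_Icc.1 (Fintype.mem_piFinset.1 hk i)
  have hPmem : ∀ m ∈ P, ∃ k ∈ Q, k - k' = m := fun m hm => Finset.mem_image.1 hm
  refine ⟨P.filter fun m => ¬ ‖intVec m‖ < R, fun m hm => not_lt.1 (Finset.mem_filter.1 hm).2,
    fun m hm i => ?_, fun m hm m' hm' i => ?_, ?_, ?_⟩
  · obtain ⟨k, hk, rfl⟩ := hPmem m (Finset.mem_filter.1 hm).1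
    have h1 := hQmem k hk i
    have h2 := hQmem k' hk' i
    rw [Pi.sub_apply, abs_le]
    omega
  · obtain ⟨k, hk, rfl⟩ := hPmem m (Finset.mem_filter.1 hm).1
    obtain ⟨l, hl, rfl⟩ := hPmem m' (Finset.mem_filter.1 hm').1
    have h1 := hQmem k hk i
    have h2 := hQmem l hl i
    rw [Pi.sub_apply, Pi.sub_apply, abs_le]
    omega
  · rw [← hPcard]
    exact_mod_cast Finset.card_filter_le _ _
  · have hsplit := Finset.sum_filter_add_sum_filter_not P (fun m => ‖intVec m‖ < R)
      fun m => ‖expSum p m‖ ^ 2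
    have hsmall : ∑ m ∈ P.filter (fun m => ‖intVec m‖ < R), ‖expSum p m‖ ^ 2 ≤
        N * ((L : ℝ) + 1) ^ d / 2 := by
      calc ∑ m ∈ P.filter (fun m => ‖intVec m‖ < R), ‖expSum p m‖ ^ 2
          ≤ ∑ m ∈ P.filter (fun m => ‖intVec m‖ < R), (N : ℝ) ^ 2 :=
            Finset.sum_le_sum fun m _ => pow_le_pow_left₀ (norm_nonneg _) (norm_expSum_le p m) 2
        _ = (P.filter fun m => ‖intVec m‖ < R).card * (N : ℝ) ^ 2 := by
            rw [Finset.sum_const, nsmul_eq_mul]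
        _ ≤ (2 * R + 1) ^ d * (N : ℝ) ^ 2 := by
            gcongr
            exact card_filter_norm_intVec_lt_le P hR
        _ = N * (2 * N * (2 * R + 1) ^ d) / 2 := by ring
        _ ≤ N * ((L : ℝ) + 1) ^ d / 2 := by gcongr
    linarith

/-- The lower bound for the mean square discrepancy up to the discretization error, where
`n₀` stands for `N ^ (1 / d)`. -/
theorem le_sum_sq_ballDiscrepancy_add {d N M : ℕ} (hd : 0 < d) (hN : 0 < N) {K c : ℝ}
    (hK : 1 ≤ K) (hc : 0 < c)
    (hball : ∀ (s : ℝ) (ξ : EuclideanSpace ℝ (Fin d)), 0 < s → K ≤ s * ‖ξ‖ →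
      c * (s ^ d) ^ 2 * (1 / (s * ‖ξ‖)) ^ (d + 1) ≤
        ‖ballFourier s ξ‖ ^ 2 + ‖ballFourier (2 * s) ξ‖ ^ 2)
    {r n₀ : ℝ} (hr : 0 < r) (hr4 : r < 1 / 4) (hn₀ : 1 ≤ n₀) (hn₀d : n₀ ^ d = N)
    (hM : 8 * K * n₀ / r ≤ M) (hMd : Real.sqrt d / r ≤ M) (a : ℤ) (p : Fin N → Fin d → ℝ) :
    c / (14 * K * Real.sqrt d ^ (d + 1)) * (r ^ d * (N / n₀)) ≤
      2 * (1 / (M : ℝ) ^ d * ∑ κ ∈ Finset.Icc (1 : ℕ) 2,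
        ∑ j ∈ Fintype.piFinset fun _ : Fin d => Finset.Ico a (a + M),
          ballDiscrepancy p (κ * r) (fun i => (j i : ℝ) / M) ^ 2) +
      4 * ((8 * K * n₀ / r) ^ d *
        (N * (volume.real (Metric.ball (0 : EuclideanSpace ℝ (Fin d)) 1) *
          (2 * (Real.sqrt d / M) * d * (4 * r) ^ (d - 1)))) ^ 2) := by
  have hsqd : 0 < Real.sqrt d := Real.sqrt_pos.2 (by exact_mod_cast hd)
  have hNr : (0 : ℝ) < N := by exact_mod_cast hN
  have hKr : 4 ≤ K / r := by
    rw [le_div_iff₀ hr]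
    linarith
  have hKn : K / r ≤ K * n₀ / r := by
    gcongr
    exact le_mul_of_one_le_right (by linarith) hn₀
  have hMpos : (0 : ℝ) < M := lt_of_lt_of_le (by positivity) hMd
  have hMnat : 0 < M := by exact_mod_cast hMpos
  set L := ⌈6 * K * n₀ / r⌉₊ with hL
  have hL1 : 6 * K * n₀ / r ≤ L := Nat.le_ceil _
  have hL2 : (L : ℝ) < 6 * K * n₀ / r + 1 := Nat.ceil_lt_add_one (by positivity)
  have e6 : 6 * K * n₀ / r = 6 * (K * n₀ / r) := by ring
  have e7 : 7 * K * n₀ / r = 7 * (K * n₀ / r) := by ring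
  have e8 : 8 * K * n₀ / r = 8 * (K * n₀ / r) := by ring
  have hL7 : (L : ℝ) ≤ 7 * K * n₀ / r := by linarith
  have hL8 : (L : ℝ) + 1 ≤ 8 * K * n₀ / r := by linarith
  have hL0 : (0 : ℝ) < L := by linarith
  have hLM : (L : ℤ) < M := by
    have : (L : ℝ) < M := by linarith
    exact_mod_cast this
  have hcard : 2 * N * (2 * (K / r) + 1) ^ d ≤ ((L : ℝ) + 1) ^ d := by
    calc 2 * N * (2 * (K / r) + 1) ^ d ≤ 2 ^ d * N * (3 * (K / r)) ^ d := by
          gcongr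
          · exact le_self_pow₀ one_le_two hd.ne'
          · linarith
      _ = (6 * K * n₀ / r) ^ d := by
          rw [← hn₀d, ← mul_pow, ← mul_pow]
          congr 1
          ring
      _ ≤ ((L : ℝ) + 1) ^ d := by
          gcongr
          linarith
  obtain ⟨T, hTR, hTL, hTT, hTcard, hTsum⟩ :=
    exists_frequencies_le_sum_sq_norm_expSum p L (by positivity : 0 ≤ K / r) hcard
  have hne : ∀ m : Fin d → ℤ, m ≠ 0 → (∀ i, |m i| ≤ L) → ∃ i, ¬ (M : ℤ) ∣ m i := by
    intro m hm hmL
    obtain ⟨i, hi⟩ := Function.ne_iff.1 hm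
    exact ⟨i, fun hdvd => hi (Int.eq_zero_of_abs_lt_dvd hdvd ((hmL i).trans_lt hLM))⟩
  have hT0 : ∀ m ∈ T, ∃ i, ¬ (M : ℤ) ∣ m i := by
    intro m hm
    refine hne m ?_ (hTL m hm)
    rintro rfl
    have h := hTR 0 hm
    have h0 : intVec (0 : Fin d → ℤ) = 0 := by
      ext i
      simp [intVec]
    rw [h0, norm_zero] at h
    linarith
  have hTT' : ∀ m ∈ T, ∀ m' ∈ T, m ≠ m' → ∃ i, ¬ (M : ℤ) ∣ m i - m' i := fun m hm m' hm' h =>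
    hne (m - m') (sub_ne_zero.2 h) (hTT m hm m' hm')
  have hdM : Real.sqrt d / M ≤ r := by
    rw [div_le_iff₀ hr] at hMd
    rw [div_le_iff₀ hMpos]
    linarith
  have hup1 := sum_sq_norm_expSum_mul_ballFourier_le hd hMnat a hdM (by linarith) p T hT0 hTT'
  have hup2 := sum_sq_norm_expSum_mul_ballFourier_le hd hMnat a (s := 2 * r) (by linarith)
    (by linarith) p T hT0 hTT'
  set V := volume.real (Metric.ball (0 : EuclideanSpace ℝ (Fin d)) 1) with hV
  have hV0 : 0 ≤ V := measureReal_nonneg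
  have hlow : ∀ m ∈ T, c * (r ^ d) ^ 2 * (1 / (r * (Real.sqrt d * L))) ^ (d + 1) ≤
      ‖ballFourier r (intVec m)‖ ^ 2 + ‖ballFourier (2 * r) (intVec m)‖ ^ 2 := by
    intro m hm
    have h1 : K ≤ r * ‖intVec m‖ := by
      have := hTR m hm
      rw [div_le_iff₀ hr] at this
      linarith
    refine le_trans ?_ (hball r (intVec m) hr h1)
    have h2 := norm_intVec_le m L (hTL m hm)
    have h3 : 0 < r * ‖intVec m‖ := by linarith
    gcongr
  have herr : ∀ s : ℝ, 0 ≤ s → s ≤ 2 * r →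
      2 * (T.card * (N * (V * (2 * (Real.sqrt d / M) * d * (2 * s) ^ (d - 1)))) ^ 2) ≤
      2 * ((8 * K * n₀ / r) ^ d *
        (N * (V * (2 * (Real.sqrt d / M) * d * (4 * r) ^ (d - 1)))) ^ 2) := by
    intro s hs hs2
    have h1 : (T.card : ℝ) ≤ (8 * K * n₀ / r) ^ d := hTcard.trans (by gcongr)
    have h2 : 2 * s ≤ 4 * r := by linarith
    gcongr
  have hsumIcc : ∀ F : ℕ → ℝ, ∑ κ ∈ Finset.Icc (1 : ℕ) 2, F κ = F 1 + F 2 := by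
    intro F
    rw [show Finset.Icc (1 : ℕ) 2 = {1, 2} by rfl, Finset.sum_pair (by norm_num)]
  have hmain : c * (r ^ d) ^ 2 * (1 / (r * (Real.sqrt d * L))) ^ (d + 1) *
      (N * ((L : ℝ) + 1) ^ d / 2) ≤
      ∑ m ∈ T, ‖expSum p m‖ ^ 2 * ‖ballFourier r (intVec m)‖ ^ 2 +
        ∑ m ∈ T, ‖expSum p m‖ ^ 2 * ‖ballFourier (2 * r) (intVec m)‖ ^ 2 := by
    rw [← Finset.sum_add_distrib]
    refine (mul_le_mul_of_nonneg_left hTsum (by positivity)).trans ?_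
    rw [Finset.mul_sum]
    refine Finset.sum_le_sum fun m hm => ?_
    rw [← mul_add, mul_comm]
    exact mul_le_mul_of_nonneg_left (hlow m hm) (by positivity)
  have hlower : c / (14 * K * Real.sqrt d ^ (d + 1)) * (r ^ d * (N / n₀)) ≤
      c * (r ^ d) ^ 2 * (1 / (r * (Real.sqrt d * L))) ^ (d + 1) *
        (N * ((L : ℝ) + 1) ^ d / 2) := by
    calc c / (14 * K * Real.sqrt d ^ (d + 1)) * (r ^ d * (N / n₀))
        = c / (2 * Real.sqrt d ^ (d + 1)) * (r ^ d * (N / (r * (7 * K * n₀ / r)))) := by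
          field_simp
          norm_num
      _ ≤ c / (2 * Real.sqrt d ^ (d + 1)) * (r ^ d * (N / (r * L))) := by gcongr
      _ = c * (r ^ d) ^ 2 * (1 / (r * (Real.sqrt d * L))) ^ (d + 1) *
            (N * (L : ℝ) ^ d / 2) := by
          rw [one_div_pow, mul_pow, mul_pow]
          field_simp
          ring
      _ ≤ _ := by
          gcongr
          linarith
  have h1 := herr r hr.le (by linarith)
  have h2 := herr (2 * r) (by linarith) le_rfl
  rw [hsumIcc]
  push_cast
  rw [one_mul, mul_add]
  linarith

/-- Discrete analogue of Montgomery's two-radii lower bound for the toroidal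
discrepancy with respect to periodized balls, for `d ≢ 1 (mod 4)`: if `M` is even
with `M ≥ C·N^{1+1/(2d)}·r⁻¹` then the discrete `ℓ²` average over the centers
`(j₁/M,…,j_d/M)`, `j ∈ J_M^d`, and the two radii `r, 2r` of the discrepancy is at
least `c·r^{d/2}·N^{1/2-1/(2d)}`. Membership of a point `y` in the periodized ball
`x + B_s + ℤ^d` is expressed through the existence of an integer vector `mm`. -/
theorem stmt19 (d : ℕ) (hd : 0 < d) (hd4 : d % 4 ≠ 1) :
    ∃ C c : ℝ, 0 < C ∧ 0 < c ∧
      ∀ (r : ℝ) (N M : ℕ), 0 < r → r < 1 / 4 → 0 < N → Even M →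
        C * (N : ℝ) ^ ((1 : ℝ) + 1 / (2 * d)) * r⁻¹ ≤ M →
        ∀ p : Fin N → Fin d → ℝ,
          c * r ^ ((d : ℝ) / 2) * (N : ℝ) ^ ((1 : ℝ) / 2 - 1 / (2 * d)) ≤
            Real.sqrt ((1 / (M : ℝ) ^ d) *
              ∑ κ ∈ Finset.Icc (1 : ℕ) 2,
                ∑ j ∈ Fintype.piFinset fun _ : Fin d => Finset.Ico (-(M : ℤ) / 2) ((M : ℤ) / 2),
                  ((∑ n, Set.indicator
                      {y : Fin d → ℝ | ∃ mm : Fin d → ℤ,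
                        Real.sqrt (∑ i, (y i - (j i : ℝ) / M - (mm i : ℝ)) ^ 2) < (κ : ℝ) * r}
                      (fun _ => (1 : ℝ)) (p n))
                    - N * (volume (Metric.ball (0 : EuclideanSpace ℝ (Fin d))
                        ((κ : ℝ) * r))).toReal) ^ 2) := by
  have hd2 : 2 ≤ d := by
    rcases Nat.lt_or_ge d 2 with h | h
    · interval_cases d
      exact absurd rfl hd4
    · exact h
  obtain ⟨K, c₁, hK, hc₁, hball⟩ := exists_le_sq_norm_ballFourier hd2 hd4
  have hdr : (0 : ℝ) < d := by exact_mod_cast hd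
  have hsqd : 0 < Real.sqrt d := Real.sqrt_pos.2 hdr
  set V := volume.real (Metric.ball (0 : EuclideanSpace ℝ (Fin d)) 1) with hV
  have hV0 : 0 ≤ V := measureReal_nonneg
  set c₀ := c₁ / (14 * K * Real.sqrt d ^ (d + 1)) with hc₀
  have hc₀pos : 0 < c₀ := by positivity
  set E := 4 * (8 * K) ^ d * (V * (2 * Real.sqrt d * d * 4 ^ (d - 1))) ^ 2 with hE
  have hE0 : 0 ≤ E := by positivity
  set C := 8 * K + d + 2 * E / c₀ with hC
  have hCE : 2 * E / c₀ ≤ C := by linarith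
  have hC1 : 1 ≤ C := by
    have : 0 ≤ 2 * E / c₀ := by positivity
    linarith
  have hCK : 8 * K ≤ C := by
    have : 0 ≤ 2 * E / c₀ := by positivity
    linarith
  have hCd : Real.sqrt d ≤ C := by
    have h1 : 0 ≤ 2 * E / c₀ := by positivity
    have h2 : Real.sqrt d ≤ d := Real.sqrt_le_self_iff.2 (Or.inr (by exact_mod_cast hd))
    linarith
  refine ⟨C, Real.sqrt (c₀ / 4), by linarith, by positivity, ?_⟩
  intro r N M hr hr4 hN hMeven hMC p
  have hNr : (0 : ℝ) < N := by exact_mod_cast hN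
  have hN1 : (1 : ℝ) ≤ N := by exact_mod_cast hN
  set n₀ := (N : ℝ) ^ (1 / (d : ℝ)) with hn₀
  have hn₀1 : 1 ≤ n₀ := Real.one_le_rpow hN1 (by positivity)
  have hn₀d : n₀ ^ d = N := by
    rw [hn₀, ← Real.rpow_natCast, ← Real.rpow_mul hNr.le, one_div_mul_cancel hdr.ne',
      Real.rpow_one]
  set y := (N : ℝ) ^ ((1 : ℝ) + 1 / (2 * d)) with hy
  have hysq : y ^ 2 = (N : ℝ) ^ 2 * n₀ := by
    rw [hy, hn₀, ← Real.rpow_natCast, ← Real.rpow_mul hNr.le, ← Real.rpow_natCast,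
      ← Real.rpow_add hNr]
    congr 1
    push_cast
    field_simp
  have hyn : n₀ ≤ y := by
    refine Real.rpow_le_rpow_of_exponent_le hN1 ?_
    have h1 : 1 / (d : ℝ) = 1 / (2 * d) + 1 / (2 * d) := by field_simp; norm_num
    have h2 : 1 / (2 * (d : ℝ)) ≤ 1 := by
      rw [div_le_one (by positivity)]
      have : (1 : ℝ) ≤ d := by exact_mod_cast hd
      linarith
    linarith
  have hy0 : 0 < y := by linarith
  rw [← div_eq_mul_inv] at hMC
  have hM8 : 8 * K * n₀ / r ≤ M := le_trans (by gcongr) hMC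
  have hMd : Real.sqrt d / r ≤ M := by
    refine le_trans ?_ hMC
    gcongr
    nlinarith
  have hMpos : (0 : ℝ) < M := lt_of_lt_of_le (by positivity) hMd
  obtain ⟨h, rfl⟩ := hMeven
  have hIco : Finset.Ico (-((h + h : ℕ) : ℤ) / 2) (((h + h : ℕ) : ℤ) / 2) =
      Finset.Ico (-(h : ℤ)) (-(h : ℤ) + ((h + h : ℕ) : ℤ)) := by
    congr 1 <;> omega
  rw [hIco]
  set M := h + h with hMdef
  have hcore := le_sum_sq_ballDiscrepancy_add hd hN hK hc₁ hball hr hr4 hn₀1 hn₀d hM8 hMd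
    (-(h : ℤ)) p
  rw [← hc₀, ← hV] at hcore
  set A := 1 / (M : ℝ) ^ d * ∑ κ ∈ Finset.Icc (1 : ℕ) 2,
    ∑ j ∈ Fintype.piFinset fun _ : Fin d => Finset.Ico (-(h : ℤ)) (-(h : ℤ) + (M : ℤ)),
      ballDiscrepancy p (κ * r) (fun i => (j i : ℝ) / M) ^ 2 with hA
  set X := r ^ d * (N / n₀) with hX
  have hX0 : 0 < X := by positivity
  have herr : 4 * ((8 * K * n₀ / r) ^ d *
      (N * (V * (2 * (Real.sqrt d / M) * d * (4 * r) ^ (d - 1)))) ^ 2) ≤ c₀ / 2 * X := by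
    have hM2 : C * ((N : ℝ) ^ 2 * n₀ / r ^ 2) ≤ (M : ℝ) ^ 2 := by
      calc C * ((N : ℝ) ^ 2 * n₀ / r ^ 2) = C * (y / r) ^ 2 := by rw [← hysq, div_pow]
        _ ≤ C ^ 2 * (y / r) ^ 2 := by
            gcongr
            exact le_self_pow₀ hC1 two_ne_zero
        _ = (C * y / r) ^ 2 := by ring
        _ ≤ (M : ℝ) ^ 2 := by gcongr
    obtain ⟨e, rfl⟩ : ∃ e, d = e + 1 := ⟨d - 1, by omega⟩
    have hleft : 4 * ((8 * K * n₀ / r) ^ (e + 1) * (N * (V * (2 * (Real.sqrt (e + 1 : ℕ) / M) *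
        (e + 1 : ℕ) * (4 * r) ^ (e + 1 - 1)))) ^ 2) =
        E * (X * ((N : ℝ) ^ 2 * n₀ / r ^ 2) / (M : ℝ) ^ 2) := by
      rw [hE, hX, ← hn₀d, Nat.add_sub_cancel, div_pow, mul_pow (8 * K) n₀, mul_pow 4 r]
      field_simp
      ring
    rw [hleft]
    have h1 : 2 * E ≤ C * c₀ := (div_le_iff₀ hc₀pos).1 hCE
    rw [← mul_div_assoc, div_le_iff₀ (by positivity)]
    calc E * (X * ((N : ℝ) ^ 2 * n₀ / r ^ 2))
        ≤ C * c₀ / 2 * (X * ((N : ℝ) ^ 2 * n₀ / r ^ 2)) := by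
          gcongr
          linarith
      _ = c₀ / 2 * X * (C * ((N : ℝ) ^ 2 * n₀ / r ^ 2)) := by ring
      _ ≤ c₀ / 2 * X * (M : ℝ) ^ 2 := by gcongr
  have hfin : c₀ / 4 * X ≤ A := by linarith
  refine Real.le_sqrt_of_sq_le (le_trans (le_of_eq ?_) hfin)
  rw [mul_pow, mul_pow, Real.sq_sqrt (by positivity), hX, mul_assoc]
  congr 2
  · rw [← Real.rpow_natCast, ← Real.rpow_mul hr.le, ← Real.rpow_natCast]
    congr 1
    push_cast
    ring
  · rw [← Real.rpow_natCast, ← Real.rpow_mul hNr.le, hn₀]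
    nth_rewrite 2 [← Real.rpow_one (N : ℝ)]
    rw [← Real.rpow_sub hNr]
    congr 1
    push_cast
    field_simp
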